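/- arXiv:1510.03481 — 4 statements merged into one kernel-verified Lean document; each statement's English description precedes it below -/
import Mathlib

section
/- Let G be a biregular bipartite graph with parts A, B, where every vertex in A has degree deg(A), and let λ₁ = largest eigenvalue, λ₃ = third largest eigenvalue in absolute value of the adjacency matrix, and μ = λ₃/λ₁. For t ≥ 2, if S ⊆ B satisfies |S| ≥ 2(t−1)|B|/deg(A), then the set R_t(S) of vertices in A with at least t neighbors in S satisfies |R_t(S)| ≥ c|A|, where c = (t−1)/(t−1 + 2·deg(A)·μ²). -/
open Matrix

namespace Matrix.IsHermitian

variable {n : Type*} [Fintype n] [DecidableEq n] {M : Matrix n n ℝ} (hM : M.IsHermitian)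

/-- Coefficient of `x` along the `i`-th vector of the eigenbasis. -/
noncomputable def eigenCoeff (i : n) (x : n → ℝ) : ℝ :=
  WithLp.ofLp (hM.eigenvectorBasis i) ⬝ᵥ x

theorem sum_eigenCoeff_mul (x y : n → ℝ) :
    ∑ i, hM.eigenCoeff i x * hM.eigenCoeff i y = x ⬝ᵥ y := by
  have h := hM.eigenvectorBasis.sum_inner_mul_inner (WithLp.toLp 2 x) (WithLp.toLp 2 y)
  simp only [EuclideanSpace.inner_eq_star_dotProduct, star_trivial] at h
  rw [dotProduct_comm x y, ← h]
  refine Finset.sum_congr rfl fun i _ => ?_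
  rw [eigenCoeff, eigenCoeff, dotProduct_comm y]

theorem eigenCoeff_mulVec (i : n) (x : n → ℝ) :
    hM.eigenCoeff i (M *ᵥ x) = hM.eigenvalues i * hM.eigenCoeff i x := by
  have hT : Mᵀ = M := by simpa [Matrix.conjTranspose_eq_transpose_of_trivial] using hM.eq
  rw [eigenCoeff, dotProduct_mulVec, ← mulVec_transpose, hT, hM.mulVec_eigenvectorBasis,
    smul_dotProduct, smul_eq_mul, eigenCoeff]

theorem mulVec_dotProduct_mulVec_self (x : n → ℝ) :
    (M *ᵥ x) ⬝ᵥ (M *ᵥ x) = ∑ i, hM.eigenvalues i ^ 2 * hM.eigenCoeff i x ^ 2 := by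
  rw [← hM.sum_eigenCoeff_mul]
  refine Finset.sum_congr rfl fun i _ => ?_
  rw [hM.eigenCoeff_mulVec]
  ring

theorem eigenvalues_sq_le {κ : ℝ} (h : ∀ z, (M *ᵥ z) ⬝ᵥ (M *ᵥ z) ≤ κ * (z ⬝ᵥ z)) (i : n) :
    hM.eigenvalues i ^ 2 ≤ κ := by
  have hv : WithLp.ofLp (hM.eigenvectorBasis i) ⬝ᵥ WithLp.ofLp (hM.eigenvectorBasis i) = 1 := by
    have h1 := hM.eigenvectorBasis.inner_eq_one i
    simpa only [EuclideanSpace.inner_eq_star_dotProduct, star_trivial] using h1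
  have h2 := h (WithLp.ofLp (hM.eigenvectorBasis i))
  rw [hM.mulVec_eigenvectorBasis, smul_dotProduct, dotProduct_smul, hv] at h2
  simp only [smul_eq_mul] at h2
  nlinarith

/-- If `M²` has two orthogonal eigenvectors for its top eigenvalue `κ`, then on their orthogonal
complement `M` is bounded by its third largest eigenvalue in absolute value. -/
theorem mulVec_dotProduct_mulVec_le_of_orthogonal {m : ℕ} (e : Fin m ≃ n) (hm : 2 < m)
    (hsort : ∀ i j, i ≤ j → |hM.eigenvalues (e j)| ≤ |hM.eigenvalues (e i)|)
    {κ : ℝ} (hκ : ∀ z, (M *ᵥ z) ⬝ᵥ (M *ᵥ z) ≤ κ * (z ⬝ᵥ z))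
    {u w : n → ℝ} (hu : M *ᵥ (M *ᵥ u) = κ • u) (hw : M *ᵥ (M *ᵥ w) = κ • w)
    (hu0 : u ≠ 0) (hw0 : w ≠ 0) (huw : u ⬝ᵥ w = 0)
    {z : n → ℝ} (hzu : z ⬝ᵥ u = 0) (hzw : z ⬝ᵥ w = 0) :
    (M *ᵥ z) ⬝ᵥ (M *ᵥ z) ≤ hM.eigenvalues (e ⟨2, hm⟩) ^ 2 * (z ⬝ᵥ z) := by
  have hpos : ∀ x : n → ℝ, 0 ≤ x ⬝ᵥ x := fun x =>
    Finset.sum_nonneg fun i _ => mul_self_nonneg (x i)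
  rcases le_or_gt κ (hM.eigenvalues (e ⟨2, hm⟩) ^ 2) with hle | hlt
  · exact (hκ z).trans (mul_le_mul_of_nonneg_right hle (hpos z))
  have hbig : ∀ i : Fin m, 2 ≤ i.val →
      hM.eigenvalues (e i) ^ 2 ≤ hM.eigenvalues (e ⟨2, hm⟩) ^ 2 := fun i hi =>
    sq_le_sq.2 (hsort _ _ (by rw [Fin.le_def]; exact hi))
  have hcoeff : ∀ {x : n → ℝ}, M *ᵥ (M *ᵥ x) = κ • x → ∀ i : Fin m, 2 ≤ i.val →
      hM.eigenCoeff (e i) x = 0 := by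
    intro x hx i hi
    have h1 : hM.eigenCoeff (e i) (M *ᵥ (M *ᵥ x)) = κ * hM.eigenCoeff (e i) x := by
      rw [hx, eigenCoeff, dotProduct_smul, smul_eq_mul, eigenCoeff]
    rw [hM.eigenCoeff_mulVec, hM.eigenCoeff_mulVec] at h1
    have h2 : (κ - hM.eigenvalues (e i) ^ 2) * hM.eigenCoeff (e i) x = 0 := by linear_combination -h1
    have := hbig i hi
    exact (mul_eq_zero.1 h2).resolve_left (by linarith)
  set i₀ : Fin m := ⟨0, by omega⟩ with hi₀
  set i₁ : Fin m := ⟨1, by omega⟩ with hi₁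
  have hne : i₀ ≠ i₁ := by simp [hi₀, hi₁]
  have hdot : ∀ {x : n → ℝ}, M *ᵥ (M *ᵥ x) = κ • x → ∀ y : n → ℝ,
      y ⬝ᵥ x = hM.eigenCoeff (e i₀) y * hM.eigenCoeff (e i₀) x
        + hM.eigenCoeff (e i₁) y * hM.eigenCoeff (e i₁) x := by
    intro x hx y
    rw [← hM.sum_eigenCoeff_mul, ← e.sum_comp]
    refine Fintype.sum_eq_add i₀ i₁ hne fun i hi => ?_
    rw [hcoeff hx i, mul_zero]
    by_contra hlt2
    have h0 : i.val ≠ 0 := fun h => hi.1 (Fin.ext h)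
    have h1 : i.val ≠ 1 := fun h => hi.2 (Fin.ext h)
    omega
  have huu : u ⬝ᵥ u ≠ 0 := fun h => hu0 (dotProduct_self_eq_zero.1 h)
  have hww : w ⬝ᵥ w ≠ 0 := fun h => hw0 (dotProduct_self_eq_zero.1 h)
  rw [hdot hu] at hzu huu
  rw [hdot hw] at hzw huw hww
  set p := hM.eigenCoeff (e i₀) u
  set q := hM.eigenCoeff (e i₁) u
  set r := hM.eigenCoeff (e i₀) w
  set s := hM.eigenCoeff (e i₁) w
  have hdet : (p * s - q * r) ≠ 0 := by
    intro h
    refine mul_ne_zero huu hww ?_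
    linear_combination (p * r + q * s) * huw + (p * s - q * r) * h
  have hz₀ : hM.eigenCoeff (e i₀) z = 0 := by
    refine (mul_eq_zero.1 ?_).resolve_left hdet
    linear_combination s * hzu - q * hzw
  have hz₁ : hM.eigenCoeff (e i₁) z = 0 := by
    refine (mul_eq_zero.1 ?_).resolve_left hdet
    linear_combination p * hzw - r * hzu
  rw [hM.mulVec_dotProduct_mulVec_self, ← hM.sum_eigenCoeff_mul z z, Finset.mul_sum,
    ← e.sum_comp, ← e.sum_comp (fun i => _ * (hM.eigenCoeff i z * hM.eigenCoeff i z))]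
  refine Finset.sum_le_sum fun i _ => ?_
  rw [← sq]
  by_cases h0 : i = i₀
  · rw [h0, hz₀]; simp
  by_cases h1 : i = i₁
  · rw [h1, hz₁]; simp
  refine mul_le_mul_of_nonneg_right (hbig i ?_) (sq_nonneg _)
  have h0' : i.val ≠ 0 := fun h => h0 (Fin.ext h)
  have h1' : i.val ≠ 1 := fun h => h1 (Fin.ext h)
  omega

end Matrix.IsHermitian

/-- Schur test for a matrix with nonnegative entries and bounded row and column sums. -/
theorem Matrix.mulVec_dotProduct_mulVec_le_of_sums {A B : Type*} [Fintype A] [Fintype B]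
    {N : Matrix A B ℝ} (hN : ∀ i j, 0 ≤ N i j) {a b : ℝ}
    (ha : ∀ i, ∑ j, N i j = a) (hb : ∀ j, ∑ i, N i j = b) (z : B → ℝ) :
    (N *ᵥ z) ⬝ᵥ (N *ᵥ z) ≤ a * b * (z ⬝ᵥ z) := by
  have hrow : ∀ i, (N *ᵥ z) i * (N *ᵥ z) i ≤ a * ∑ j, N i j * z j ^ 2 := by
    intro i
    rw [← sq, ← ha i]
    exact Finset.sum_sq_le_sum_mul_sum_of_sq_le_mul _ (fun j _ => hN i j)
      (fun j _ => mul_nonneg (hN i j) (sq_nonneg _)) (fun j _ => le_of_eq (by ring))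
  calc (N *ᵥ z) ⬝ᵥ (N *ᵥ z) ≤ ∑ i, a * ∑ j, N i j * z j ^ 2 :=
        Finset.sum_le_sum fun i _ => hrow i
    _ = a * ∑ j, (∑ i, N i j) * z j ^ 2 := by
        rw [← Finset.mul_sum, Finset.sum_comm]
        simp_rw [Finset.sum_mul]
    _ = a * b * (z ⬝ᵥ z) := by
        simp_rw [hb, ← Finset.mul_sum, dotProduct, ← sq]
        ring

/-- If `d` sums to zero and is at most `-δ` on `T`, its second moment is large. -/
theorem Finset.card_mul_sq_mul_card_le {A : Type*} [Fintype A] [DecidableEq A] (T : Finset A)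
    (d : A → ℝ) (hd : ∑ x, d x = 0) {δ : ℝ} (hδ : 0 ≤ δ) (hT : ∀ x ∈ T, d x ≤ -δ) :
    (T.card : ℝ) * δ ^ 2 * Fintype.card A ≤ (∑ x, d x ^ 2) * (Tᶜ.card : ℝ) := by
  have hsplit : ∀ f : A → ℝ, ∑ x, f x = ∑ x ∈ T, f x + ∑ x ∈ Tᶜ, f x := fun f =>
    (Finset.sum_add_sum_compl T f).symm
  have hcard : (Fintype.card A : ℝ) = T.card + Tᶜ.card := by
    rw [← Finset.card_add_card_compl T]; push_cast; rfl
  have h1 : (∑ x ∈ T, d x) ^ 2 ≤ T.card * ∑ x ∈ T, d x ^ 2 := sq_sum_le_card_mul_sum_sq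
  have h2 : (∑ x ∈ Tᶜ, d x) ^ 2 ≤ Tᶜ.card * ∑ x ∈ Tᶜ, d x ^ 2 := sq_sum_le_card_mul_sum_sq
  have h3 : ∑ x ∈ T, d x ≤ -(T.card * δ) := by
    calc ∑ x ∈ T, d x ≤ ∑ x ∈ T, -δ := Finset.sum_le_sum hT
      _ = _ := by simp
  have h4 : (T.card : ℝ) * δ ^ 2 ≤ ∑ x ∈ T, d x ^ 2 := by
    calc (T.card : ℝ) * δ ^ 2 = ∑ x ∈ T, δ ^ 2 := by simp
      _ ≤ _ := Finset.sum_le_sum fun x hx => by nlinarith [hT x hx]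
  rw [hsplit] at hd
  rw [hcard, hsplit (fun x => d x ^ 2)]
  have hT0 : (0 : ℝ) ≤ T.card := Nat.cast_nonneg _
  have hR0 : (0 : ℝ) ≤ Tᶜ.card := Nat.cast_nonneg _
  have h5 : (T.card * δ : ℝ) ^ 2 ≤ (∑ x ∈ Tᶜ, d x) ^ 2 :=
    pow_le_pow_left₀ (by positivity) (by linarith) 2
  nlinarith [mul_le_mul_of_nonneg_right h4 hR0]

/-- The singular value bound for the biadjacency matrix of a biregular bipartite graph. -/
theorem Matrix.biregular_mulVec_dotProduct_mulVec_le
    {A B : Type*} [Fintype A] [Fintype B] [DecidableEq A] [DecidableEq B] [Nonempty A] [Nonempty B]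
    {a b : ℝ}
    {N : Matrix A B ℝ} (hN : ∀ i j, 0 ≤ N i j)
    (ha : ∀ i, ∑ j, N i j = a) (hb : ∀ j, ∑ i, N i j = b)
    (hM : (Matrix.fromBlocks 0 N Nᵀ 0).IsHermitian) {m : ℕ}
    (e : Fin m ≃ (A ⊕ B)) (hm : 2 < m)
    (hsort : ∀ i j, i ≤ j → |hM.eigenvalues (e j)| ≤ |hM.eigenvalues (e i)|) :
    (∀ i, hM.eigenvalues i ^ 2 ≤ a * b) ∧ ∀ z : B → ℝ, ∑ j, z j = 0 →
      (N *ᵥ z) ⬝ᵥ (N *ᵥ z) ≤ hM.eigenvalues (e ⟨2, hm⟩) ^ 2 * (z ⬝ᵥ z) := by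
  have hmul : ∀ (x : A → ℝ) (y : B → ℝ), Matrix.fromBlocks 0 N Nᵀ 0 *ᵥ Sum.elim x y =
      Sum.elim (N *ᵥ y) (Nᵀ *ᵥ x) := fun x y => by
    rw [Matrix.fromBlocks_mulVec]; simp
  have hdot : ∀ (x x' : A → ℝ) (y y' : B → ℝ),
      Sum.elim x y ⬝ᵥ Sum.elim x' y' = x ⬝ᵥ x' + y ⬝ᵥ y' := fun x x' y y' => by
    simp [dotProduct]
  have hκ : ∀ z, (Matrix.fromBlocks 0 N Nᵀ 0 *ᵥ z) ⬝ᵥ (Matrix.fromBlocks 0 N Nᵀ 0 *ᵥ z)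
      ≤ (a * b) * (z ⬝ᵥ z) := by
    intro z
    rw [← Sum.elim_comp_inl_inr z, hmul, hdot, hdot]
    have h1 := Matrix.mulVec_dotProduct_mulVec_le_of_sums hN ha hb (z ∘ Sum.inr)
    have h2 := Matrix.mulVec_dotProduct_mulVec_le_of_sums (N := Nᵀ) (fun i j => hN j i) hb ha
      (z ∘ Sum.inl)
    linarith
  refine ⟨hM.eigenvalues_sq_le hκ, fun z hz => ?_⟩
  have hN1 : N *ᵥ (fun _ => 1) = fun _ => a := by
    ext i; simp [mulVec, dotProduct, ha]
  have hNT1 : Nᵀ *ᵥ (fun _ => 1) = fun _ => b := by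
    ext i; simp [mulVec, dotProduct, hb]
  have hNb : N *ᵥ (fun _ => b) = fun _ => a * b := by
    ext i; simp [mulVec, dotProduct, ← Finset.sum_mul, ha]
  have hNTa : Nᵀ *ᵥ (fun _ => a) = fun _ => a * b := by
    ext i; simp [mulVec, dotProduct, ← Finset.sum_mul, hb, mul_comm b]
  have key := hM.mulVec_dotProduct_mulVec_le_of_orthogonal e hm hsort hκ
    (u := Sum.elim (fun _ => 1) 0) (w := Sum.elim 0 (fun _ => 1))
    (by rw [hmul, hmul, hNT1, mulVec_zero, mulVec_zero, hNb]; ext (i | i) <;> simp)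
    (by rw [hmul, hmul, hN1, mulVec_zero, mulVec_zero, hNTa]; ext (i | i) <;> simp)
    (fun h => by simpa using congrFun h (Sum.inl (Classical.arbitrary A)))
    (fun h => by simpa using congrFun h (Sum.inr (Classical.arbitrary B)))
    (by rw [hdot]; simp)
    (z := Sum.elim 0 z) (by rw [hdot]; simp)
    (by rw [hdot]; simpa [dotProduct] using hz)
  rw [hmul, hdot, hdot] at key
  simpa using key

/-- Lund–Saraf: In a bipartite biregular graph (degree `a` on `A`),
with adjacency-matrix eigenvalues ordered by decreasing absolute value (via `e`),
`λ₁` the largest, `λ₃` the third, `μ = λ₃/λ₁`: if `S ⊆ B` has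
`|S| ≥ 2(t-1)|B|/deg(A)`, then the set `R_t(S)` of vertices of `A` with at least
`t` neighbors in `S` has `|R_t(S)| ≥ c|A|` with
`c = (t-1)/((t-1) + 2·deg(A)·μ²)`. -/
theorem lund_saraf_rich_vertices
    (A B : Type) [Fintype A] [Fintype B] [DecidableEq A] [DecidableEq B]
    (a b : ℕ) (ha' : 0 < a) (hb' : 0 < b)
    (N : Matrix A B ℝ) (hN : ∀ i j, N i j = 0 ∨ N i j = 1)
    (ha : ∀ i, ∑ j, N i j = (a : ℝ)) (hb : ∀ j, ∑ i, N i j = (b : ℝ))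
    (M : Matrix (A ⊕ B) (A ⊕ B) ℝ)
    (hMdef : M = Matrix.fromBlocks 0 N Nᵀ 0)
    (hM : M.IsHermitian)
    (hcard : 2 < Fintype.card (A ⊕ B))
    (e : Fin (Fintype.card (A ⊕ B)) ≃ (A ⊕ B))
    (hsort : ∀ i j, i ≤ j → |hM.eigenvalues (e j)| ≤ |hM.eigenvalues (e i)|)
    (t : ℕ) (ht : 2 ≤ t)
    (S : Finset B)
    (hS : 2 * ((t : ℝ) - 1) * (Fintype.card B : ℝ) / (a : ℝ) ≤ S.card)
    (μ c : ℝ)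
    (hμ : μ = hM.eigenvalues (e ⟨2, hcard⟩) /
        hM.eigenvalues (e ⟨0, by omega⟩))
    (hc : c = ((t : ℝ) - 1) / (((t : ℝ) - 1) + 2 * (a : ℝ) * μ ^ 2)) :
    c * (Fintype.card A : ℝ) ≤
      ((Finset.univ.filter fun x : A =>
          t ≤ (S.filter fun y => N x y = 1).card).card : ℝ) := by
  have ht1 : (0 : ℝ) < (t : ℝ) - 1 := by
    have : (2 : ℝ) ≤ t := by exact_mod_cast ht
    linarith
  have haR : (0 : ℝ) < a := by exact_mod_cast ha'
  rcases isEmpty_or_nonempty A with hA | hA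
  · simp
  have hB : Nonempty B := by
    by_contra h
    rw [not_nonempty_iff] at h
    have := ha (Classical.arbitrary A)
    rw [Finset.univ_eq_empty, Finset.sum_empty] at this
    exact haR.ne this
  subst hMdef
  have hN0 : ∀ i j, 0 ≤ N i j := fun i j => by rcases hN i j with h | h <;> simp [h]
  obtain ⟨hle, hbound⟩ := Matrix.biregular_mulVec_dotProduct_mulVec_le hN0 ha hb
    hM e hcard hsort
  set l1 := hM.eigenvalues (e ⟨0, by omega⟩) with hl1
  set l3 := hM.eigenvalues (e ⟨2, hcard⟩) with hl3
  have hμ3 : l3 ^ 2 ≤ μ ^ 2 * (a * b) := by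
    have h31 : |l3| ≤ |l1| := hsort _ _ (by simp)
    by_cases h0 : l1 = 0
    · have : l3 = 0 := by simpa [h0] using h31
      rw [this, zero_pow two_ne_zero]
      positivity
    · have : l3 ^ 2 = μ ^ 2 * l1 ^ 2 := by rw [hμ]; field_simp
      rw [this]
      exact mul_le_mul_of_nonneg_left (hle _) (sq_nonneg _)
  have hcB : (0 : ℝ) < Fintype.card B := by exact_mod_cast Fintype.card_pos
  have hcA : (0 : ℝ) < Fintype.card A := by exact_mod_cast Fintype.card_pos
  have hedge : (Fintype.card A : ℝ) * a = Fintype.card B * b := by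
    have h := Finset.sum_comm (s := Finset.univ) (t := Finset.univ) (f := fun i j => N i j)
    simpa [ha, hb] using h
  set R := Finset.univ.filter fun x : A => t ≤ (S.filter fun y => N x y = 1).card with hR
  set σ : ℝ := (S.card : ℝ) with hσ
  set β : ℝ := (Fintype.card B : ℝ) with hβ
  set D : ℝ := a * σ / β with hD
  have hDt : 2 * ((t : ℝ) - 1) ≤ D := by
    rw [hD, le_div_iff₀ hcB]
    rw [div_le_iff₀ haR] at hS
    linarith
  set z : B → ℝ := fun j => (if j ∈ S then 1 else 0) - σ / β with hz
  have hz0 : ∑ j, z j = 0 := by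
    simp only [hz, Finset.sum_sub_distrib, Finset.sum_ite_mem, Finset.univ_inter,
      Finset.sum_const, Finset.card_univ, nsmul_eq_mul, mul_one]
    field_simp
    simp [hσ, hβ, mul_comm]
  have hzz : z ⬝ᵥ z ≤ σ := by
    have h1 : z ⬝ᵥ z = ∑ j, (if j ∈ S then 1 else 0) * z j := by
      have h2 : z ⬝ᵥ z = ∑ j, (if j ∈ S then 1 else 0) * z j - σ / β * ∑ j, z j := by
        rw [Finset.mul_sum, ← Finset.sum_sub_distrib]
        exact Finset.sum_congr rfl fun j _ => by rw [← sub_mul]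
      rw [h2, hz0]; ring
    rw [h1]
    calc ∑ j, (if j ∈ S then (1 : ℝ) else 0) * z j ≤ ∑ j, if j ∈ S then (1 : ℝ) else 0 := by
          refine Finset.sum_le_sum fun j _ => ?_
          have : 0 ≤ σ / β := by positivity
          by_cases hj : j ∈ S <;> simp [hz, hj, this]
      _ = σ := by simp [hσ]
  have hNz : ∀ x, (N *ᵥ z) x = ((S.filter fun y => N x y = 1).card : ℝ) - D := by
    intro x
    have h1 : ∀ y, N x y = if N x y = 1 then 1 else 0 := fun y => by
      rcases hN x y with h | h <;> simp [h]
    have h2 : ((S.filter fun y => N x y = 1).card : ℝ) = ∑ y ∈ S, N x y := by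
      rw [Finset.sum_congr rfl fun y _ => h1 y]
      simp
    rw [h2]
    simp only [mulVec, dotProduct, hz, mul_sub, Finset.sum_sub_distrib, ← Finset.sum_mul, ha]
    simp [hD, mul_div_assoc]
  have hsum : ∑ x, (N *ᵥ z) x = 0 := by
    simp only [mulVec, dotProduct]
    rw [Finset.sum_comm]
    simp_rw [← Finset.sum_mul, hb, ← Finset.mul_sum, hz0, mul_zero]
  have hmom := Finset.card_mul_sq_mul_card_le Rᶜ (N *ᵥ z) hsum (δ := D / 2) (by linarith) (by
    intro x hx
    have hx' : (S.filter fun y => N x y = 1).card + 1 ≤ t := by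
      have hlt : (S.filter fun y => N x y = 1).card < t := by simpa [hR] using hx
      exact hlt
    have hx'' : ((S.filter fun y => N x y = 1).card : ℝ) + 1 ≤ t := by exact_mod_cast hx'
    rw [hNz]
    linarith)
  rw [compl_compl] at hmom
  have hsq : ∑ x, (N *ᵥ z) x ^ 2 ≤ μ ^ 2 * (a * b) * σ := by
    calc ∑ x, (N *ᵥ z) x ^ 2 = (N *ᵥ z) ⬝ᵥ (N *ᵥ z) := by simp [dotProduct, sq]
      _ ≤ l3 ^ 2 * (z ⬝ᵥ z) := hbound z hz0
      _ ≤ l3 ^ 2 * σ := mul_le_mul_of_nonneg_left hzz (sq_nonneg _)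
      _ ≤ _ := mul_le_mul_of_nonneg_right hμ3 (Nat.cast_nonneg _)
  have hT : (Rᶜ.card : ℝ) = Fintype.card A - R.card := by
    rw [← Finset.card_add_card_compl R]; push_cast; ring
  set ρ : ℝ := (R.card : ℝ) with hρ
  set α : ℝ := (Fintype.card A : ℝ) with hα
  have hρ0 : 0 ≤ ρ := Nat.cast_nonneg _
  have hT0 : 0 ≤ α - ρ := hT ▸ Nat.cast_nonneg _
  rw [hT] at hmom
  have hD0 : 0 < D := by linarith
  have hDβ : D * β = a * σ := by rw [hD]; field_simp
  have hmain : (α - ρ) * ((t : ℝ) - 1) ≤ 2 * a * μ ^ 2 * ρ := by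
    have h1 : (α - ρ) * (D / 2) ^ 2 * α ≤ μ ^ 2 * (a * b) * σ * ρ :=
      hmom.trans (mul_le_mul_of_nonneg_right hsq hρ0)
    have h2 : μ ^ 2 * (a * b) * σ * ρ = D * α * (a * μ ^ 2 * ρ) := by
      linear_combination (-(μ ^ 2 * b * ρ)) * hDβ - D * μ ^ 2 * ρ * hedge
    have h3 : D * α * ((α - ρ) * D) ≤ D * α * (4 * (a * μ ^ 2 * ρ)) := by
      rw [h2] at h1
      linarith
    have h4 := le_of_mul_le_mul_left h3 (mul_pos hD0 hcA)
    have h5 := mul_le_mul_of_nonneg_left hDt hT0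
    linarith
  have hden : 0 < ((t : ℝ) - 1) + 2 * a * μ ^ 2 := by positivity
  rw [hc, div_mul_eq_mul_div, div_le_iff₀ hden]
  linarith
end

section
/- Let 𝒫 be a set of k-planes and ℋ a set of h-planes in F_q^d with h ≥ 2k+1. Then the number of incidences I(𝒫,ℋ) = #{(P,H) ∈ 𝒫×ℋ : P ⊆ H} satisfies |I(𝒫,ℋ) − |𝒫||ℋ|/q^{(d−h)(k+1)}| ≤ C·√(2k+1)·q^{((d−h)h + k(2h−d−k+1))/2}·√(|𝒫||ℋ|) for an absolute constant C (one may take the bound with (1+o(1)) factors as q → ∞). -/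
open Pointwise

/-- A k-plane in `F^d`: a coset of a k-dimensional linear subspace. -/
def IsAffinePlane (F : Type) [Field F] (d k : ℕ) (S : Set (Fin d → F)) : Prop :=
  ∃ (W : Submodule F (Fin d → F)) (x : Fin d → F),
    Module.finrank F W = k ∧ S = x +ᵥ (W : Set (Fin d → F))

open Classical in
/-- Over a finite field, the number of elements of a subspace. -/
lemma card_filter_mem_submodule {F V : Type*} [Field F] [Fintype F] [AddCommGroup V] [Module F V]
    [Fintype V] (U : Submodule F V) :
    (Finset.univ.filter (· ∈ U)).card = Fintype.card F ^ Module.finrank F U := by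
  rw [← Fintype.card_subtype, ← Module.card_eq_pow_finrank (K := F) (V := U)]

open Classical in
/-- The number of tuples with entries in a subspace. -/
lemma card_filter_forall_mem_submodule {F V : Type*} [Field F] [Fintype F] [AddCommGroup V]
    [Module F V] [Fintype V] (U : Submodule F V) (n : ℕ) :
    (Finset.univ.filter (fun b : Fin n → V => ∀ i, b i ∈ U)).card =
      Fintype.card F ^ (n * Module.finrank F U) := by
  have : (Finset.univ.filter (fun b : Fin n → V => ∀ i, b i ∈ U)) =
      Fintype.piFinset (fun _ => Finset.univ.filter (· ∈ U)) := by
    ext b; simp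
  rw [this, Fintype.card_piFinset]
  simp only [card_filter_mem_submodule, Finset.prod_const, Finset.card_univ, Fintype.card_fin]
  rw [← pow_mul, mul_comm]

open Classical in
/-- At least half of the `m`-tuples in a subspace `Q` complete a given subspace `A` of
codimension `m` in `Q` to all of `Q`. -/
lemma exists_finset_sup_span_eq {F V : Type*} [Field F] [Fintype F] [AddCommGroup V] [Module F V]
    [Fintype V] (hq : 3 ≤ Fintype.card F) (Q : Submodule F V) (m : ℕ) :
    ∀ A : Submodule F V, A ≤ Q → Module.finrank F A + m = Module.finrank F Q →
      ∃ S : Finset (Fin m → V), (∀ b ∈ S, A ⊔ Submodule.span F (Set.range b) = Q) ∧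
        ((Fintype.card F : ℝ) ^ Module.finrank F Q) ^ m *
          ((1 + ((Fintype.card F : ℝ) ^ m)⁻¹) / 2) ≤ S.card := by
  have hq' : (3 : ℝ) ≤ Fintype.card F := by exact_mod_cast hq
  induction m with
  | zero =>
    intro A hA hr
    refine ⟨Finset.univ, fun b _ => ?_, by simp⟩
    rw [Set.range_eq_empty, Submodule.span_empty, sup_bot_eq]
    exact Submodule.eq_of_le_of_finrank_eq hA (by simpa using hr)
  | succ m ih =>
    intro A hA hr
    have key : ∀ v : V, v ∈ Q → v ∉ A →
        ∃ S : Finset (Fin m → V),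
        (∀ b ∈ S, A ⊔ Submodule.span F (Set.range (Fin.cons v b : Fin (m + 1) → V)) = Q) ∧
        ((Fintype.card F : ℝ) ^ Module.finrank F Q) ^ m *
          ((1 + ((Fintype.card F : ℝ) ^ m)⁻¹) / 2) ≤ S.card := by
      intro v hv hvA
      obtain ⟨S, hS, hc⟩ := ih (A ⊔ Submodule.span F {v})
        (sup_le hA (by simpa using hv)) (by
          have h1 := Submodule.finrank_sup_add_finrank_inf_eq A (Submodule.span F {v})
          have h2 : A ⊓ Submodule.span F {v} = ⊥ := by
            rw [← disjoint_iff]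
            exact (Submodule.disjoint_span_singleton_of_notMem hvA)
          rw [h2, finrank_bot, finrank_span_singleton (by rintro rfl; exact hvA A.zero_mem)] at h1
          omega)
      refine ⟨S, fun b hb => ?_, hc⟩
      rw [← hS b hb, Fin.range_cons, Submodule.span_insert, sup_assoc]
    choose S hS hc using key
    let T : Finset V := Finset.univ.filter (fun v => v ∈ Q ∧ v ∉ A)
    have hT : (T.card : ℝ) = (Fintype.card F : ℝ) ^ Module.finrank F Q *
        (1 - ((Fintype.card F : ℝ) ^ (m + 1))⁻¹) := by
      have h1 : T = Finset.univ.filter (· ∈ Q) \ Finset.univ.filter (· ∈ A) := by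
        ext v; simp [T]
      rw [h1, Finset.cast_card_sdiff (by intro v; simpa using @hA v), card_filter_mem_submodule,
        card_filter_mem_submodule, ← hr, mul_sub, mul_one]
      push_cast
      rw [pow_add, mul_inv_cancel_right₀ (by positivity)]
    let B : Finset (Fin (m + 1) → V) := T.biUnion fun v =>
      if h : v ∈ Q ∧ v ∉ A then (S v h.1 h.2).image (fun b => (Fin.cons v b : Fin (m + 1) → V))
      else ∅
    refine ⟨B, ?_, ?_⟩
    · intro b hb
      obtain ⟨v, hv, hb⟩ := Finset.mem_biUnion.1 hb
      have hv' : v ∈ Q ∧ v ∉ A := by simpa [T] using hv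
      rw [dif_pos hv', Finset.mem_image] at hb
      obtain ⟨c, hcS, rfl⟩ := hb
      exact hS v hv'.1 hv'.2 c hcS
    · rw [Finset.card_biUnion]
      · push_cast
        refine le_trans ?_ (Finset.card_nsmul_le_sum T _
          (((Fintype.card F : ℝ) ^ Module.finrank F Q) ^ m *
          ((1 + ((Fintype.card F : ℝ) ^ m)⁻¹) / 2)) ?_)
        · rw [nsmul_eq_mul, hT]
          set y := ((Fintype.card F : ℝ) ^ (m + 1))⁻¹ with hy
          have hy1 : ((Fintype.card F : ℝ) ^ m)⁻¹ = Fintype.card F * y := by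
            rw [hy, pow_succ]; field_simp
          have hy0 : 0 < y := by positivity
          have hy2 : Fintype.card F * y ≤ 1 := by
            rw [← hy1]; exact inv_le_one_of_one_le₀ (one_le_pow₀ (by linarith))
          rw [hy1]
          set X := (Fintype.card F : ℝ) ^ Module.finrank F Q
          have hX : 0 ≤ X ^ (m + 1) := by positivity
          have : X ^ (m + 1) * ((1 + y) / 2) ≤
              X ^ (m + 1) * ((1 - y) * ((1 + Fintype.card F * y) / 2)) :=
            mul_le_mul_of_nonneg_left (by nlinarith) hX
          calc _ ≤ _ := this
            _ = _ := by ring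
        · intro v hv
          have hv' : v ∈ Q ∧ v ∉ A := by simpa [T] using hv
          rw [dif_pos hv',
            Finset.card_image_of_injective _ fun b c h => (Fin.cons_inj.1 h).2]
          exact hc v hv'.1 hv'.2
      · intro v hv w hw hvw
        have hv' : v ∈ Q ∧ v ∉ A := by simpa [T] using hv
        have hw' : w ∈ Q ∧ w ∉ A := by simpa [T] using hw
        simp only [Function.onFun]
        rw [dif_pos hv', dif_pos hw', Finset.disjoint_left]
        intro b hb hb'
        obtain ⟨c, -, rfl⟩ := Finset.mem_image.1 hb
        obtain ⟨c', -, h⟩ := Finset.mem_image.1 hb'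
        exact hvw (Fin.cons_inj.1 h).1.symm

lemma exists_finset_sup_span_eq_half {F V : Type*} [Field F] [Fintype F] [AddCommGroup V]
    [Module F V] [Fintype V] (hq : 3 ≤ Fintype.card F) (A Q : Submodule F V) (hA : A ≤ Q) (m : ℕ)
    (hm : Module.finrank F A + m = Module.finrank F Q) :
    ∃ S : Finset (Fin m → V), (∀ b ∈ S, A ⊔ Submodule.span F (Set.range b) = Q) ∧
        (Fintype.card F : ℝ) ^ (Module.finrank F Q * m) / 2 ≤ S.card := by
  obtain ⟨S, hS, hc⟩ := exists_finset_sup_span_eq hq Q m A hA hm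
  refine ⟨S, hS, le_trans ?_ hc⟩
  rw [pow_mul, div_eq_mul_inv]
  gcongr
  have : (0 : ℝ) < ((Fintype.card F : ℝ) ^ m)⁻¹ := by positivity
  linarith

open Classical in
/-- Upper bound for the number of `K`-dimensional subspaces meeting a given one in a
`j`-dimensional subspace. -/
lemma card_mul_le_of_finrank_inf_eq {F V : Type*} [Field F] [Fintype F] [AddCommGroup V]
    [Module F V] [Fintype V] (hq : 3 ≤ Fintype.card F) {K j : ℕ} (hj : j ≤ K)
    (P : Submodule F V) (hP : Module.finrank F P = K) (Qs : Finset (Submodule F V))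
    (hQs : ∀ Q ∈ Qs, Module.finrank F Q = K ∧
      Module.finrank F (P ⊓ Q : Submodule F V) = j) :
    (Qs.card : ℝ) * (Fintype.card F : ℝ) ^ (j * j + K * (K - j)) ≤
      4 * (Fintype.card F : ℝ) ^ (K * j + Module.finrank F V * (K - j)) := by
  have h1 : ∀ Q : Submodule F V, ∃ S : Finset ((Fin j → V) × (Fin (K - j) → V)), Q ∈ Qs →
      (∀ b ∈ S, (∀ i, b.1 i ∈ P) ∧
        Submodule.span F (Set.range b.1) ⊔ Submodule.span F (Set.range b.2) = Q) ∧
        (Fintype.card F : ℝ) ^ (j * j + K * (K - j)) / 4 ≤ S.card := by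
    intro Q
    by_cases hQ : Q ∈ Qs
    · obtain ⟨hQK, hQj⟩ := hQs Q hQ
      obtain ⟨S, hS, hSc⟩ := exists_finset_sup_span_eq_half hq ⊥ (P ⊓ Q) bot_le j (by simp [hQj])
      obtain ⟨S', hS', hSc'⟩ := exists_finset_sup_span_eq_half hq (P ⊓ Q) Q inf_le_right (K - j)
        (by omega)
      refine ⟨S ×ˢ S', fun _ => ⟨?_, ?_⟩⟩
      · rintro ⟨a, b⟩ hab
        obtain ⟨ha, hb⟩ := Finset.mem_product.1 hab
        have ha' := hS a ha
        rw [bot_sup_eq] at ha'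
        refine ⟨fun i => ?_, by simpa only [ha'] using hS' b hb⟩
        have : a i ∈ P ⊓ Q := ha' ▸ Submodule.subset_span (Set.mem_range_self i)
        exact this.1
      · rw [Finset.card_product, pow_add]
        push_cast
        rw [hQj] at hSc
        rw [hQK] at hSc'
        calc _ = (Fintype.card F : ℝ) ^ (j * j) / 2 * ((Fintype.card F : ℝ) ^ (K * (K - j)) / 2) := by
              ring
          _ ≤ _ := by gcongr
    · exact ⟨∅, fun h => absurd h hQ⟩
  choose S hS using h1
  have hU : Qs.biUnion S ⊆ (Finset.univ.filter (fun b : Fin j → V => ∀ i, b i ∈ P)) ×ˢ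
      Finset.univ := by
    intro b hb
    obtain ⟨Q, hQ, hb⟩ := Finset.mem_biUnion.1 hb
    simpa using ((hS Q hQ).1 b hb).1
  have hcard := Finset.card_le_card hU
  rw [Finset.card_product, card_filter_forall_mem_submodule, Finset.card_univ, Fintype.card_fun,
    Fintype.card_fin, Module.card_eq_pow_finrank (K := F) (V := V), hP, Finset.card_biUnion,
    ← pow_mul, ← pow_add, mul_comm j] at hcard
  · have h2 : (Qs.card : ℝ) * ((Fintype.card F : ℝ) ^ (j * j + K * (K - j)) / 4) ≤
        ∑ Q ∈ Qs, ((S Q).card : ℝ) := by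
      rw [← nsmul_eq_mul]
      exact Finset.card_nsmul_le_sum _ _ _ fun Q hQ => (hS Q hQ).2
    have h3 : ∑ Q ∈ Qs, ((S Q).card : ℝ) ≤
        (Fintype.card F : ℝ) ^ (K * j + Module.finrank F V * (K - j)) := by exact_mod_cast hcard
    linarith
  · intro Q hQ Q' hQ' hne
    simp only [Function.onFun]
    rw [Finset.disjoint_left]
    intro b hb hb'
    exact hne (((hS Q hQ).1 b hb).2.symm.trans ((hS Q' hQ').1 b hb').2)

open Classical in
/-- Number of tuples in the dual space that vanish on a subspace. -/
lemma sum_ite_dualAnnihilator {F V : Type*} [Field F] [Fintype F] [AddCommGroup V]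
    [Module F V] [Module.Finite F V] [Fintype (Module.Dual F V)] (n : ℕ) (P : Submodule F V) :
    ∑ φ : Fin n → Module.Dual F V, (if ∀ i, φ i ∈ P.dualAnnihilator then (1 : ℝ) else 0) =
      (Fintype.card F : ℝ) ^ (n * (Module.finrank F V - Module.finrank F P)) := by
  rw [Finset.sum_boole, card_filter_forall_mem_submodule,
    ← Subspace.finrank_add_finrank_dualAnnihilator_eq P, Nat.add_sub_cancel_left]
  push_cast
  rfl

open Classical in
/-- The events that a uniformly random `n`-tuple in the dual space vanishes on given
`K`-dimensional subspaces are uncorrelated when the subspaces are independent. -/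
lemma sum_sub_mul_sub_le {F V : Type*} [Field F] [Fintype F] [AddCommGroup V]
    [Module F V] [Module.Finite F V] [Fintype (Module.Dual F V)] {n K : ℕ}
    (hD : 2 * K ≤ Module.finrank F V) (P Q : Submodule F V) (hP : Module.finrank F P = K)
    (hQ : Module.finrank F Q = K) :
    ∑ φ : Fin n → Module.Dual F V,
      ((if ∀ i, φ i ∈ P.dualAnnihilator then (1 : ℝ) else 0) -
        1 / (Fintype.card F : ℝ) ^ (n * K)) *
      ((if ∀ i, φ i ∈ Q.dualAnnihilator then (1 : ℝ) else 0) -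
        1 / (Fintype.card F : ℝ) ^ (n * K)) ≤
    if Module.finrank F (P ⊓ Q : Submodule F V) = 0 then 0 else
      (Fintype.card F : ℝ) ^
        (n * (Module.finrank F V - 2 * K + Module.finrank F (P ⊓ Q : Submodule F V))) := by
  have hq0 : (0 : ℝ) < Fintype.card F := by exact_mod_cast Fintype.card_pos
  have hsum := Submodule.finrank_sup_add_finrank_inf_eq P Q
  have hle : Module.finrank F (P ⊓ Q : Submodule F V) ≤ K :=
    hP ▸ Submodule.finrank_mono inf_le_left
  set j := Module.finrank F (P ⊓ Q : Submodule F V)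
  have hsup : Module.finrank F (P ⊔ Q : Submodule F V) = 2 * K - j := by omega
  set δ : ℝ := 1 / (Fintype.card F : ℝ) ^ (n * K) with hδ
  have h1 : ∀ φ : Fin n → Module.Dual F V,
      ((if ∀ i, φ i ∈ P.dualAnnihilator then (1 : ℝ) else 0) - δ) *
      ((if ∀ i, φ i ∈ Q.dualAnnihilator then (1 : ℝ) else 0) - δ) =
      (if ∀ i, φ i ∈ (P ⊔ Q).dualAnnihilator then (1 : ℝ) else 0)
      - δ * (if ∀ i, φ i ∈ P.dualAnnihilator then (1 : ℝ) else 0)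
      - δ * (if ∀ i, φ i ∈ Q.dualAnnihilator then (1 : ℝ) else 0) + δ * δ := by
    intro φ
    have : (∀ i, φ i ∈ (P ⊔ Q).dualAnnihilator) ↔
        (∀ i, φ i ∈ P.dualAnnihilator) ∧ ∀ i, φ i ∈ Q.dualAnnihilator := by
      rw [Submodule.dualAnnihilator_sup_eq]
      simp only [Submodule.mem_inf, forall_and]
    simp only [this]
    by_cases h : ∀ i, φ i ∈ P.dualAnnihilator <;> by_cases h' : ∀ i, φ i ∈ Q.dualAnnihilator <;>
      simp only [h, h', and_true, and_false, if_true, if_false, implies_true] <;> ring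
  simp only [h1]
  rw [Finset.sum_add_distrib, Finset.sum_sub_distrib, Finset.sum_sub_distrib, ← Finset.mul_sum,
    ← Finset.mul_sum, sum_ite_dualAnnihilator, sum_ite_dualAnnihilator, sum_ite_dualAnnihilator,
    hsup, hP, hQ, Finset.sum_const, Finset.card_univ, Fintype.card_fun, Fintype.card_fin,
    Module.card_eq_pow_finrank (K := F) (V := Module.Dual F V), Subspace.dual_finrank_eq, nsmul_eq_mul]
  have e1 : Module.finrank F V - (2 * K - j) = Module.finrank F V - 2 * K + j := by omega
  obtain ⟨r, hr⟩ : ∃ r, Module.finrank F V = 2 * K + r := ⟨_, (Nat.add_sub_cancel' hD).symm⟩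
  have hx : (Fintype.card F : ℝ) ^ (n * K) ≠ 0 := by positivity
  have e2 : δ * (Fintype.card F : ℝ) ^ (n * (Module.finrank F V - K)) =
      (Fintype.card F : ℝ) ^ (n * r) := by
    rw [hδ, hr, show n * (2 * K + r - K) = n * K + n * r by
      rw [← mul_add]; congr 1; omega, pow_add]
    field_simp
  have e3 : (((Fintype.card F ^ Module.finrank F V) ^ n : ℕ) : ℝ) * (δ * δ) =
      (Fintype.card F : ℝ) ^ (n * r) := by
    push_cast
    rw [hδ, hr, ← pow_mul, show (2 * K + r) * n = n * K + n * K + n * r by ring, pow_add, pow_add]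
    field_simp
  rw [e1, e2, e3, hr, Nat.add_sub_cancel_left]
  have hpos : (0 : ℝ) < (Fintype.card F : ℝ) ^ (n * r) := by positivity
  split_ifs with hj
  · rw [hj]; simp
  · linarith

open Classical in
/-- The sum over `Q` of the covariance bounds against a fixed subspace `P`. -/
lemma sum_ite_finrank_inf_le {F V : Type*} [Field F] [Fintype F] [AddCommGroup V]
    [Module F V] [Fintype V] (hq : 3 ≤ Fintype.card F) {n K : ℕ}
    (hD : n + 2 * K ≤ Module.finrank F V) (Qs : Finset (Submodule F V))
    (hQs : ∀ Q ∈ Qs, Module.finrank F Q = K) (P : Submodule F V) (hP : Module.finrank F P = K) :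
    ∑ Q ∈ Qs, (if Module.finrank F (P ⊓ Q : Submodule F V) = 0 then 0 else
      (Fintype.card F : ℝ) ^
        (n * (Module.finrank F V - 2 * K + Module.finrank F (P ⊓ Q : Submodule F V)))) ≤
    4 * K * (Fintype.card F : ℝ) ^ ((K : ℤ) + Module.finrank F V * (K - 1) - 1 - K * (K - 1)
      + n * (Module.finrank F V - 2 * K + 1)) := by
  set q : ℝ := (Fintype.card F : ℝ) with hqdef
  have hq1 : (1 : ℝ) ≤ q := by
    have : (3 : ℝ) ≤ q := by rw [hqdef]; exact_mod_cast hq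
    linarith
  have hq0 : q ≠ 0 := by positivity
  obtain ⟨r, hr⟩ : ∃ r, Module.finrank F V = n + 2 * K + r := ⟨_, (Nat.add_sub_cancel' hD).symm⟩
  set M : ℤ := (K : ℤ) + Module.finrank F V * (K - 1) - 1 - K * (K - 1)
      + n * (Module.finrank F V - 2 * K + 1) with hM
  have hmaps : ∀ Q ∈ Qs, Module.finrank F (P ⊓ Q : Submodule F V) ∈ Finset.range (K + 1) := by
    intro Q _
    rw [Finset.mem_range, Nat.lt_succ_iff, ← hP]
    exact Submodule.finrank_mono inf_le_left
  rw [← Finset.sum_fiberwise_of_maps_to hmaps, Finset.sum_range_succ']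
  have h0 : ∑ Q ∈ Qs with Module.finrank F (P ⊓ Q : Submodule F V) = 0,
      (if Module.finrank F (P ⊓ Q : Submodule F V) = 0 then 0 else
      q ^ (n * (Module.finrank F V - 2 * K + Module.finrank F (P ⊓ Q : Submodule F V)))) = 0 :=
    Finset.sum_eq_zero fun Q hQ => if_pos (Finset.mem_filter.1 hQ).2
  rw [h0, add_zero]
  have hbound : ∀ i ∈ Finset.range K,
      ∑ Q ∈ Qs with Module.finrank F (P ⊓ Q : Submodule F V) = i + 1,
      (if Module.finrank F (P ⊓ Q : Submodule F V) = 0 then 0 else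
      q ^ (n * (Module.finrank F V - 2 * K + Module.finrank F (P ⊓ Q : Submodule F V)))) ≤
      4 * q ^ M := by
    intro i hi
    rw [Finset.mem_range] at hi
    rw [Finset.sum_congr rfl (g := fun _ => q ^ (n * (Module.finrank F V - 2 * K + (i + 1))))
      (fun Q hQ => by
        rw [(Finset.mem_filter.1 hQ).2, if_neg (Nat.succ_ne_zero i)]), Finset.sum_const,
      nsmul_eq_mul]
    have hc := card_mul_le_of_finrank_inf_eq hq (j := i + 1) hi P hP
      {Q ∈ Qs | Module.finrank F (P ⊓ Q : Submodule F V) = i + 1} (fun Q hQ => by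
        rw [Finset.mem_filter] at hQ
        exact ⟨hQs Q hQ.1, hQ.2⟩)
    rw [← hqdef] at hc
    obtain ⟨s, rfl⟩ : ∃ s, K = i + 1 + s := ⟨_, (Nat.add_sub_cancel' hi).symm⟩
    rw [Nat.add_sub_cancel_left] at hc
    have hd : Module.finrank F V - 2 * (i + 1 + s) = n + r := by omega
    rw [hd]
    have hpos : 0 < q ^ ((i + 1) * (i + 1) + (i + 1 + s) * s) := by positivity
    refine le_of_mul_le_mul_right ?_ hpos
    calc _ = ({Q ∈ Qs | Module.finrank F (P ⊓ Q : Submodule F V) = i + 1}.card : ℝ) *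
          q ^ ((i + 1) * (i + 1) + (i + 1 + s) * s) * q ^ (n * (n + r + (i + 1))) := by ring
      _ ≤ 4 * q ^ ((i + 1 + s) * (i + 1) + Module.finrank F V * s) *
          q ^ (n * (n + r + (i + 1))) := by gcongr
      _ = 4 * q ^ (((i + 1 + s) * (i + 1) + Module.finrank F V * s + n * (n + r + (i + 1)) : ℕ)
          : ℤ) := by rw [mul_assoc, ← pow_add, zpow_natCast]
      _ ≤ 4 * q ^ (M + ((i + 1) * (i + 1) + (i + 1 + s) * s : ℕ)) := by
          gcongr
          rw [hM, hr]
          push_cast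
          have : (0 : ℤ) ≤ i * r := by positivity
          nlinarith [sq_nonneg (i : ℤ)]
      _ = _ := by rw [zpow_add₀ hq0, zpow_natCast, mul_assoc]
  refine (Finset.sum_le_sum hbound).trans_eq ?_
  rw [Finset.sum_const, Finset.card_range, nsmul_eq_mul]
  ring

open Classical in
/-- Incidence bound for linear subspaces of dimension `K` and codimension `n`. -/
lemma sq_incidences_sub_le {F V : Type*} [Field F] [Fintype F] [AddCommGroup V]
    [Module F V] [Fintype V] (hq : 3 ≤ Fintype.card F) {n K : ℕ}
    (hD : n + 2 * K ≤ Module.finrank F V) (Ps Hs : Finset (Submodule F V))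
    (hPs : ∀ P ∈ Ps, Module.finrank F P = K)
    (hHs : ∀ H ∈ Hs, Module.finrank F H + n = Module.finrank F V) :
    ((((Ps ×ˢ Hs).filter fun PH => PH.1 ≤ PH.2).card : ℝ) -
      (Ps.card : ℝ) * (Hs.card : ℝ) / (Fintype.card F : ℝ) ^ (n * K)) ^ 2 ≤
    8 * K * (Fintype.card F : ℝ) ^ ((K : ℤ) + Module.finrank F V * (K - 1) - 1 - K * (K - 1)
      + n * (Module.finrank F V - 2 * K + 1) - n * n) * ((Ps.card : ℝ) * (Hs.card : ℝ)) := by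
  have : Finite (Module.Dual F V) := Module.finite_of_finite F
  let _ : Fintype (Module.Dual F V) := Fintype.ofFinite _
  have hq0 : (0 : ℝ) < Fintype.card F := by exact_mod_cast Fintype.card_pos
  set M : ℤ := (K : ℤ) + Module.finrank F V * (K - 1) - 1 - K * (K - 1)
      + n * (Module.finrank F V - 2 * K + 1) with hM
  set δ : ℝ := 1 / (Fintype.card F : ℝ) ^ (n * K) with hδ
  let g : Submodule F V → (Fin n → Module.Dual F V) → ℝ := fun P φ =>
    (if ∀ i, φ i ∈ P.dualAnnihilator then (1 : ℝ) else 0) - δ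
  let Y : Submodule F V → ℝ := fun H => ∑ P ∈ Ps, ((if P ≤ H then (1 : ℝ) else 0) - δ)
  have hsecond : ∑ φ, (∑ P ∈ Ps, g P φ) ^ 2 ≤ Ps.card * (4 * K * (Fintype.card F : ℝ) ^ M) := by
    calc ∑ φ, (∑ P ∈ Ps, g P φ) ^ 2 = ∑ P ∈ Ps, ∑ Q ∈ Ps, ∑ φ, g P φ * g Q φ := by
          simp only [sq, Finset.sum_mul_sum]
          rw [Finset.sum_comm]
          exact Finset.sum_congr rfl fun P _ => Finset.sum_comm
      _ ≤ ∑ P ∈ Ps, 4 * K * (Fintype.card F : ℝ) ^ M := by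
          refine Finset.sum_le_sum fun P hP => ?_
          refine (Finset.sum_le_sum fun Q hQ => ?_).trans
            (sum_ite_finrank_inf_le hq hD Ps hPs P (hPs P hP))
          exact sum_sub_mul_sub_le (by omega) P Q (hPs P hP) (hPs Q hQ)
      _ = _ := by rw [Finset.sum_const, nsmul_eq_mul]
  have hS : ∀ H : Submodule F V, ∃ S : Finset (Fin n → Module.Dual F V), H ∈ Hs →
      (∀ φ ∈ S, Submodule.span F (Set.range φ) = H.dualAnnihilator) ∧
        (Fintype.card F : ℝ) ^ (n * n) / 2 ≤ S.card := by
    intro H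
    by_cases hH : H ∈ Hs
    · have hr : Module.finrank F H.dualAnnihilator = n := by
        have := Subspace.finrank_add_finrank_dualAnnihilator_eq H
        have := hHs H hH
        omega
      obtain ⟨S, hS, hc⟩ := exists_finset_sup_span_eq_half hq ⊥ H.dualAnnihilator bot_le n
        (by simp [hr])
      exact ⟨S, fun _ => ⟨fun φ hφ => by simpa using hS φ hφ, by rwa [hr] at hc⟩⟩
    · exact ⟨∅, fun h => absurd h hH⟩
  choose S hS using hS
  have hdisj : (Hs : Set (Submodule F V)).PairwiseDisjoint S := by
    intro H hH H' hH' hne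
    simp only [Function.onFun]
    rw [Finset.disjoint_left]
    intro φ hφ hφ'
    exact hne (Subspace.dualAnnihilator_inj.1
      (((hS H hH).1 φ hφ).symm.trans ((hS H' hH').1 φ hφ')))
  have hgY : ∀ H ∈ Hs, ∀ φ ∈ S H, ∑ P ∈ Ps, g P φ = Y H := by
    intro H hH φ hφ
    refine Finset.sum_congr rfl fun P _ => ?_
    have : (∀ i, φ i ∈ P.dualAnnihilator) ↔ P ≤ H := by
      rw [← Subspace.dualAnnihilator_le_dualAnnihilator_iff, ← (hS H hH).1 φ hφ,
        Submodule.span_le, Set.range_subset_iff]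
      rfl
    simp only [g, this]
  have hY : (∑ H ∈ Hs, Y H ^ 2) * ((Fintype.card F : ℝ) ^ (n * n) / 2) ≤
      Ps.card * (4 * K * (Fintype.card F : ℝ) ^ M) := by
    refine le_trans ?_ hsecond
    calc (∑ H ∈ Hs, Y H ^ 2) * ((Fintype.card F : ℝ) ^ (n * n) / 2)
        ≤ ∑ H ∈ Hs, ∑ φ ∈ S H, (∑ P ∈ Ps, g P φ) ^ 2 := by
          rw [Finset.sum_mul]
          refine Finset.sum_le_sum fun H hH => ?_
          rw [Finset.sum_congr rfl fun φ hφ => by rw [hgY H hH φ hφ], Finset.sum_const,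
            nsmul_eq_mul, mul_comm]
          exact mul_le_mul_of_nonneg_right (hS H hH).2 (sq_nonneg _)
      _ = ∑ φ ∈ Hs.biUnion S, (∑ P ∈ Ps, g P φ) ^ 2 := (Finset.sum_biUnion hdisj).symm
      _ ≤ _ := Finset.sum_le_sum_of_subset_of_nonneg (Finset.subset_univ _)
          fun _ _ _ => sq_nonneg _
  have hI : (((Ps ×ˢ Hs).filter fun PH => PH.1 ≤ PH.2).card : ℝ) -
      (Ps.card : ℝ) * (Hs.card : ℝ) / (Fintype.card F : ℝ) ^ (n * K) = ∑ H ∈ Hs, Y H := by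
    simp only [Y, Finset.sum_sub_distrib, Finset.sum_const, nsmul_eq_mul]
    rw [← Finset.sum_boole, Finset.sum_product_right, hδ]
    ring
  rw [hI, zpow_sub₀ hq0.ne', ← Nat.cast_mul, zpow_natCast]
  refine sq_sum_le_card_mul_sum_sq.trans ?_
  have hpos : (0 : ℝ) < (Fintype.card F : ℝ) ^ (n * n) := by positivity
  have hY' : ∑ H ∈ Hs, Y H ^ 2 ≤
      Ps.card * (4 * K * (Fintype.card F : ℝ) ^ M) / ((Fintype.card F : ℝ) ^ (n * n) / 2) :=
    (le_div_iff₀ (by positivity)).2 hY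
  calc _ ≤ _ := mul_le_mul_of_nonneg_left hY' (Nat.cast_nonneg _)
    _ = _ := by field_simp; ring

/-- The homogenization of a subset of `F^d`: the span of its copy at height one. -/
def homogenize (F : Type) [Field F] (d : ℕ) (S : Set (Fin d → F)) :
    Submodule F ((Fin d → F) × F) :=
  Submodule.span F ((fun x => (x, (1 : F))) '' S)

lemma homogenize_coset {F : Type} [Field F] {d : ℕ} (W : Submodule F (Fin d → F))
    (x : Fin d → F) :
    homogenize F d (x +ᵥ (W : Set (Fin d → F))) =
      W.map (LinearMap.inl F (Fin d → F) F) ⊔ Submodule.span F {(x, 1)} := by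
  apply le_antisymm
  · rw [homogenize, Submodule.span_le]
    rintro _ ⟨_, ⟨w, hw, rfl⟩, rfl⟩
    refine Submodule.mem_sup.2 ⟨(w, 0), ⟨w, hw, rfl⟩, (x, 1), Submodule.mem_span_singleton_self _,
      ?_⟩
    simp [add_comm]
  · have hmem : ∀ w ∈ W, ((x + w, 1) : (Fin d → F) × F) ∈
        homogenize F d (x +ᵥ (W : Set (Fin d → F))) := fun w hw =>
      Submodule.subset_span ⟨x + w, ⟨w, hw, rfl⟩, rfl⟩
    have hx := hmem 0 W.zero_mem
    rw [add_zero] at hx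
    refine sup_le ?_ (by simpa using hx)
    rintro _ ⟨w, hw, rfl⟩
    simpa using Submodule.sub_mem _ (hmem w hw) hx

lemma finrank_homogenize {F : Type} [Field F] {d k : ℕ} {S : Set (Fin d → F)}
    (hS : IsAffinePlane F d k S) : Module.finrank F (homogenize F d S) = k + 1 := by
  obtain ⟨W, x, hW, rfl⟩ := hS
  have h := Submodule.finrank_sup_add_finrank_inf_eq (W.map (LinearMap.inl F (Fin d → F) F))
    (Submodule.span F {(x, 1)})
  have hx : ((x, 1) : (Fin d → F) × F) ∉ W.map (LinearMap.inl F (Fin d → F) F) := by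
    rintro ⟨w, -, hw⟩
    simpa using congrArg Prod.snd hw
  rw [(Submodule.disjoint_span_singleton_of_notMem hx).eq_bot, finrank_bot,
    finrank_span_singleton (by simp), ← homogenize_coset,
    LinearEquiv.finrank_eq (Submodule.equivMapOfInjective _ LinearMap.inl_injective W).symm, hW] at h
  exact h

lemma mem_homogenize_iff {F : Type} [Field F] {d k : ℕ} {S : Set (Fin d → F)}
    (hS : IsAffinePlane F d k S) (y : Fin d → F) : (y, 1) ∈ homogenize F d S ↔ y ∈ S := by
  refine ⟨fun hy => ?_, fun hy => Submodule.subset_span ⟨y, hy, rfl⟩⟩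
  obtain ⟨W, x, -, rfl⟩ := hS
  rw [homogenize_coset] at hy
  obtain ⟨_, ⟨w, hw, rfl⟩, b, hb, h⟩ := Submodule.mem_sup.1 hy
  obtain ⟨c, rfl⟩ := Submodule.mem_span_singleton.1 hb
  have h2 : c = 1 := by simpa using congrArg Prod.snd h
  have h1 := congrArg Prod.fst h
  subst h2
  refine ⟨w, hw, ?_⟩
  simpa [add_comm] using h1

lemma homogenize_le_iff {F : Type} [Field F] {d h : ℕ} {S T : Set (Fin d → F)}
    (hT : IsAffinePlane F d h T) : homogenize F d S ≤ homogenize F d T ↔ S ⊆ T :=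
  ⟨fun hle y hy => (mem_homogenize_iff hT y).1 (hle (Submodule.subset_span ⟨y, hy, rfl⟩)),
    fun hST => Submodule.span_mono (Set.image_mono hST)⟩

lemma homogenize_injOn {F : Type} [Field F] {d k : ℕ} {Ps : Finset (Set (Fin d → F))}
    (hPs : ∀ P ∈ Ps, IsAffinePlane F d k P) : Set.InjOn (homogenize F d) Ps := fun P hP Q hQ h =>
  Set.Subset.antisymm ((homogenize_le_iff (hPs Q hQ)).1 h.le)
    ((homogenize_le_iff (hPs P hP)).1 h.ge)

open Classical in
/-- There is an absolute constant `C` such that for any set `Ps` of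
k-planes and any set `Hs` of h-planes in `F_q^d` with `h ≥ 2k+1`, the number of
incidences `I(Ps,Hs) = #{(P,H) : P ⊆ H}` satisfies
`|I(Ps,Hs) - |Ps||Hs|/q^{(d-h)(k+1)}| ≤ C √(2k+1) q^{((d-h)h + k(2h-d-k+1))/2} √(|Ps||Hs|)`. -/
theorem incidences_k_planes_h_planes :
    ∃ C : ℝ, 0 < C ∧
      ∀ (F : Type) [Field F] [Fintype F], Odd (Fintype.card F) →
        ∀ (d k h : ℕ), 2 * k + 1 ≤ h → h < d →
          ∀ (Ps Hs : Finset (Set (Fin d → F))),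
            (∀ P ∈ Ps, IsAffinePlane F d k P) →
            (∀ H ∈ Hs, IsAffinePlane F d h H) →
            |(((Ps ×ˢ Hs).filter fun PH => PH.1 ⊆ PH.2).card : ℝ) -
                (Ps.card : ℝ) * (Hs.card : ℝ) /
                  (Fintype.card F : ℝ) ^ ((d - h) * (k + 1))| ≤
              C * Real.sqrt (2 * k + 1) *
                Real.sqrt ((Fintype.card F : ℝ) ^
                  (((d : ℤ) - h) * h + k * (2 * h - d - k + 1))) *
                Real.sqrt ((Ps.card : ℝ) * (Hs.card : ℝ)) := by
  refine ⟨3, by norm_num, ?_⟩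
  intro F _ _ hodd d k h hkh hhd Ps Hs hPs hHs
  have hq : 3 ≤ Fintype.card F := by
    have := Fintype.one_lt_card (α := F)
    obtain ⟨m, hm⟩ := hodd
    omega
  have hq0 : (0 : ℝ) < Fintype.card F := by exact_mod_cast Fintype.card_pos
  have hfr : Module.finrank F ((Fin d → F) × F) = d + 1 := by simp
  have hPi := homogenize_injOn hPs
  have hHi := homogenize_injOn hHs
  have hmain := sq_incidences_sub_le hq (n := d - h) (K := k + 1) (by rw [hfr]; omega)
    (Ps.image (homogenize F d)) (Hs.image (homogenize F d))
    (by simpa using fun P hP => finrank_homogenize (hPs P hP))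
    (by
      rw [hfr]
      simp only [Finset.mem_image, forall_exists_index, and_imp, forall_apply_eq_imp_iff₂]
      intro H hH
      rw [finrank_homogenize (hHs H hH)]
      omega)
  have hinc : (((Ps.image (homogenize F d)) ×ˢ (Hs.image (homogenize F d))).filter
      fun PH => PH.1 ≤ PH.2) =
      ((Ps ×ˢ Hs).filter fun PH => PH.1 ⊆ PH.2).image
        (Prod.map (homogenize F d) (homogenize F d)) := by
    rw [← Finset.prodMap_image_product, Finset.filter_image]
    congr 1
    refine Finset.filter_congr fun PH hPH => ?_
    exact homogenize_le_iff (hHs _ (Finset.mem_product.1 hPH).2)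
  rw [hinc, Finset.card_image_of_injOn, Finset.card_image_of_injOn hPi,
    Finset.card_image_of_injOn hHi, hfr] at hmain
  · refine Real.abs_le_sqrt hmain |>.trans ?_
    rw [← Real.sqrt_sq (show (0 : ℝ) ≤ 3 by norm_num), ← Real.sqrt_mul (by positivity),
      ← Real.sqrt_mul (by positivity), ← Real.sqrt_mul (by positivity)]
    apply Real.sqrt_le_sqrt
    have hexp : (((k + 1 : ℕ) : ℤ) + ((d + 1 : ℕ) : ℤ) * (((k + 1 : ℕ) : ℤ) - 1) - 1 -
        ((k + 1 : ℕ) : ℤ) * (((k + 1 : ℕ) : ℤ) - 1) + ((d - h : ℕ) : ℤ) *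
        (((d + 1 : ℕ) : ℤ) - 2 * ((k + 1 : ℕ) : ℤ) + 1) - ((d - h : ℕ) : ℤ) * ((d - h : ℕ) : ℤ)) =
        ((d : ℤ) - h) * h + k * (2 * h - d - k + 1) := by
      push_cast [Nat.cast_sub hhd.le]
      ring
    rw [hexp]
    gcongr
    · norm_num
    · push_cast
      have : (0 : ℝ) ≤ k := Nat.cast_nonneg k
      linarith
  · rintro ⟨P, H⟩ hPH ⟨P', H'⟩ hPH' heq
    simp only [Finset.coe_filter, Finset.mem_product, Set.mem_ofPred_eq] at hPH hPH'
    simp only [Prod.map_apply, Prod.mk.injEq] at heq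
    exact Prod.ext (hPi hPH.1.1 hPH'.1.1 heq.1) (hHi hPH.1.2 hPH'.1.2 heq.2)
end

section
/- For any integer t ≥ 2, let ℋ be a set of h-planes in F_q^d with |ℋ| ≥ 2(t−1)·q^{(d−h)(k+1)}, where h ≥ 2k+1. Then the number of k-planes contained in at least t of the h-planes of ℋ is at least c·q^{(d−k)(k+1)}, where c = (t−1)/((t−1) + 2q^{(d−h−1)(h−k)+k}) (up to (1+o(1)) factors as q → ∞). -/
open Pointwise

section

open Finset

theorem sum_sq_incidence_le {X Y : Type*} [Fintype X] [Fintype Y] (e : X → Y → ℝ) {A D c : ℝ}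
    (hA : ∀ y, ∑ x, e x y = A) (hD : ∀ x, ∑ y, e x y = D)
    (hc : ∀ x x', c ≤ ∑ y, e x y * e x' y) (f : X → ℝ) (hf : ∑ x, f x = 0) :
    ∑ y, (∑ x, f x * e x y) ^ 2 ≤ (D * A - Fintype.card X * c) * ∑ x, f x ^ 2 := by
  set C : X → X → ℝ := fun x x' => ∑ y, e x y * e x' y with hC
  have hsymm : ∀ x x', C x x' = C x' x := fun x x' =>
    Finset.sum_congr rfl fun y _ => mul_comm _ _
  have hrow : ∀ x, ∑ x', (C x x' - c) = D * A - Fintype.card X * c := by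
    intro x
    rw [Finset.sum_sub_distrib, Finset.sum_comm]
    simp only [← Finset.mul_sum, hA, ← Finset.sum_mul, hD]
    simp
  have hzero : ∑ x, ∑ x', f x * f x' * c = 0 := by
    simp only [← Finset.sum_mul, ← Finset.mul_sum, hf]
    simp
  calc ∑ y, (∑ x, f x * e x y) ^ 2
      = ∑ x, ∑ x', f x * f x' * C x x' := by
        simp only [sq, Finset.sum_mul_sum]
        simp only [hC, Finset.mul_sum]
        rw [Finset.sum_comm]
        refine Finset.sum_congr rfl fun x _ => ?_
        rw [Finset.sum_comm]
        exact Finset.sum_congr rfl fun x' _ => Finset.sum_congr rfl fun y _ => by ring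
    _ = ∑ x, ∑ x', f x * f x' * (C x x' - c) := by
        simp only [mul_sub, Finset.sum_sub_distrib, hzero, sub_zero]
    _ ≤ ∑ x, ∑ x', (f x ^ 2 / 2 * (C x x' - c) + f x' ^ 2 / 2 * (C x x' - c)) := by
        refine Finset.sum_le_sum fun x _ => Finset.sum_le_sum fun x' _ => ?_
        have h : 0 ≤ C x x' - c := sub_nonneg.2 (hc x x')
        nlinarith [mul_nonneg (sq_nonneg (f x - f x')) h]
    _ = (D * A - Fintype.card X * c) * ∑ x, f x ^ 2 := by
        simp only [Finset.sum_add_distrib]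
        rw [Finset.sum_comm (f := fun x x' => f x' ^ 2 / 2 * (C x x' - c))]
        have hcol : ∀ x, ∑ x', (C x' x - c) = D * A - Fintype.card X * c := fun x => by
          rw [← hrow x]
          exact Finset.sum_congr rfl fun x' _ => by rw [hsymm]
        simp only [← Finset.mul_sum, hrow, hcol, ← Finset.sum_mul, ← Finset.sum_div]
        ring

theorem card_poor_le {X Y : Type*} [Fintype X] [Fintype Y] [Nonempty X] (e : X → Y → ℝ)
    {A D c a : ℝ}
    (hA : ∀ y, ∑ x, e x y = A) (hD : ∀ x, ∑ y, e x y = D)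
    (hc : ∀ x x', c ≤ ∑ y, e x y * e x' y) (B : Finset Y) (Q : Finset X)
    (hQ : ∀ x ∈ Q, ∑ y ∈ B, e x y ≤ a) (ha : a ≤ #B * A / Fintype.card X) :
    (#B * A / Fintype.card X - a) ^ 2 * #Q ≤
      #B * (D * A - Fintype.card X * c) * (Fintype.card X - #Q) / Fintype.card X := by
  classical
  have hN : (0 : ℝ) < Fintype.card X := by exact_mod_cast Fintype.card_pos
  set N : ℝ := (Fintype.card X : ℝ)
  set f : X → ℝ := fun x => (if x ∈ Q then 1 else 0) - #Q / N with hfdef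
  have hf : ∑ x, f x = 0 := by
    simp only [hfdef, Finset.sum_sub_distrib, Finset.sum_ite_mem, Finset.univ_inter,
      Finset.sum_const, Finset.card_univ, nsmul_eq_mul, mul_one]
    change _ - N * _ = 0
    field_simp
    ring
  have hf2 : ∑ x, f x ^ 2 = #Q * (N - #Q) / N := by
    have h1 : ∀ x, f x ^ 2 = (if x ∈ Q then 1 - 2 * (#Q / N) else 0) + (#Q / N) ^ 2 := by
      intro x
      simp only [hfdef]
      split_ifs <;> ring
    simp only [h1, Finset.sum_add_distrib, Finset.sum_ite_mem, Finset.univ_inter,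
      Finset.sum_const, Finset.card_univ, nsmul_eq_mul]
    change _ + N * _ = _
    field_simp
    ring
  have hquad := sum_sq_incidence_le e hA hD hc f hf
  have hg : ∑ y ∈ B, ∑ x, f x * e x y ≤ -((#B * A / N - a) * #Q) := by
    have h1 : ∀ y, ∑ x, f x * e x y = ∑ x ∈ Q, e x y - #Q / N * A := by
      intro y
      simp only [hfdef, sub_mul, Finset.sum_sub_distrib, ite_mul, one_mul, zero_mul,
        Finset.sum_ite_mem, Finset.univ_inter, ← Finset.mul_sum, hA]
    simp only [h1, Finset.sum_sub_distrib, Finset.sum_const, nsmul_eq_mul]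
    rw [Finset.sum_comm]
    have h2 : ∑ x ∈ Q, ∑ y ∈ B, e x y ≤ #Q * a := by
      simpa using Finset.sum_le_sum hQ
    have h3 : (#B : ℝ) * (#Q / N * A) = #B * A / N * #Q := by ring
    rw [h3]
    linarith
  have hsq : ((#B * A / N - a) * #Q) ^ 2 ≤ #B * ∑ y, (∑ x, f x * e x y) ^ 2 := by
    have h0 : 0 ≤ (#B * A / N - a) * #Q := mul_nonneg (by linarith) (by positivity)
    calc ((#B * A / N - a) * #Q) ^ 2 ≤ (∑ y ∈ B, ∑ x, f x * e x y) ^ 2 := by nlinarith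
      _ ≤ #B * ∑ y ∈ B, (∑ x, f x * e x y) ^ 2 := sq_sum_le_card_mul_sum_sq
      _ ≤ _ := by
        gcongr
        exact Finset.subset_univ B
  rcases (Nat.cast_nonneg (α := ℝ) #Q).eq_or_lt with h0 | hpos
  · have hR : 0 ≤ D * A - N * c := by
      obtain ⟨x⟩ := ‹Nonempty X›
      have h1 : ∑ x' : X, c ≤ ∑ x' : X, ∑ y, e x y * e x' y := Finset.sum_le_sum fun x' _ => hc x x'
      rw [Finset.sum_comm] at h1
      simp only [← Finset.mul_sum, hA, ← Finset.sum_mul, hD] at h1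
      simp only [Finset.sum_const, Finset.card_univ, nsmul_eq_mul] at h1
      exact sub_nonneg.2 h1
    rw [← h0]
    simp only [mul_zero, sub_zero]
    positivity
  · refine le_of_mul_le_mul_right ?_ hpos
    calc (#B * A / N - a) ^ 2 * #Q * #Q = ((#B * A / N - a) * #Q) ^ 2 := by ring
      _ ≤ #B * ((D * A - N * c) * (#Q * (N - #Q) / N)) := by
        rw [← hf2]
        exact hsq.trans (by gcongr)
      _ = _ := by ring

/-- The Gaussian binomial coefficient `[n, r]_q` as a real number. -/
noncomputable def gaussBinom (q : ℝ) (n r : ℕ) : ℝ :=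
  ∏ i ∈ Finset.range r, (q ^ n - q ^ i) / (q ^ r - q ^ i)

theorem gaussBinom_pos {q : ℝ} (hq : 1 < q) {n r : ℕ} (h : r ≤ n) : 0 < gaussBinom q n r := by
  refine Finset.prod_pos fun i hi => ?_
  have hi := Finset.mem_range.1 hi
  exact div_pos (sub_pos.2 (pow_lt_pow_right₀ hq (by omega)))
    (sub_pos.2 (pow_lt_pow_right₀ hq hi))

theorem gaussBinom_self {q : ℝ} (hq : 1 < q) (n : ℕ) : gaussBinom q n n = 1 := by
  refine Finset.prod_eq_one fun i hi => div_self ?_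
  exact (sub_pos.2 (pow_lt_pow_right₀ hq (Finset.mem_range.1 hi))).ne'

theorem gaussBinom_succ_succ {q : ℝ} (hq : 1 < q) (n r : ℕ) :
    gaussBinom q (n + 1) (r + 1) * (q ^ (r + 1) - 1) = gaussBinom q n r * (q ^ (n + 1) - 1) := by
  have hr : q ^ (r + 1) - 1 ≠ 0 := (sub_pos.2 (one_lt_pow₀ hq (by omega))).ne'
  have hq0 : q ≠ 0 := by positivity
  unfold gaussBinom
  rw [Finset.prod_range_succ', pow_zero, mul_assoc, div_mul_cancel₀ _ hr]
  congr 1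
  refine Finset.prod_congr rfl fun i _ => ?_
  rw [pow_succ, pow_succ, pow_succ, ← sub_mul, ← sub_mul, mul_div_mul_right _ _ hq0]

theorem gaussBinom_mul_pow_le {q : ℝ} (hq : 1 < q) {k h : ℕ} (hk : k ≤ h) (p : ℕ) :
    gaussBinom q h k * q ^ (p * k) ≤ gaussBinom q (h + p) k := by
  have hpow : q ^ (p * k) = ∏ _i ∈ Finset.range k, q ^ p := by simp [pow_mul]
  rw [hpow]
  unfold gaussBinom
  rw [← Finset.prod_mul_distrib]
  have hden : ∀ i ∈ Finset.range k, 0 < q ^ k - q ^ i := fun i hi =>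
    sub_pos.2 (pow_lt_pow_right₀ hq (Finset.mem_range.1 hi))
  have hnum : ∀ i ∈ Finset.range k, 0 < q ^ h - q ^ i := fun i hi =>
    sub_pos.2 (pow_lt_pow_right₀ hq ((Finset.mem_range.1 hi).trans_le hk))
  refine Finset.prod_le_prod (fun i hi => ?_) fun i hi => ?_
  · have := hden i hi
    have := hnum i hi
    positivity
  · have := hden i hi
    rw [div_mul_eq_mul_div]
    gcongr
    have h1 : 1 ≤ q ^ p := one_le_pow₀ hq.le
    have h2 : 0 < q ^ i := by positivity
    rw [pow_add]
    nlinarith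

theorem gaussBinom_le_mul_pow {q : ℝ} (hq : 1 < q) {k h : ℕ} (hk : k ≤ h) (p : ℕ) :
    gaussBinom q (h + p) k * (1 - 1 / q) ^ k ≤ gaussBinom q h k * q ^ (p * k) := by
  have hpow : q ^ (p * k) = ∏ _i ∈ Finset.range k, q ^ p := by simp [pow_mul]
  have hpow' : (1 - 1 / q) ^ k = ∏ _i ∈ Finset.range k, (1 - 1 / q) := by simp
  rw [hpow, hpow']
  unfold gaussBinom
  rw [← Finset.prod_mul_distrib, ← Finset.prod_mul_distrib]
  have hη : 0 < 1 - 1 / q := sub_pos.2 ((div_lt_one (by positivity)).2 hq)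
  have hden : ∀ i ∈ Finset.range k, 0 < q ^ k - q ^ i := fun i hi =>
    sub_pos.2 (pow_lt_pow_right₀ hq (Finset.mem_range.1 hi))
  have hnum : ∀ i ∈ Finset.range k, 0 < q ^ (h + p) - q ^ i := fun i hi =>
    sub_pos.2 (pow_lt_pow_right₀ hq (by have := Finset.mem_range.1 hi; omega))
  refine Finset.prod_le_prod (fun i hi => ?_) fun i hi => ?_
  · have := hden i hi
    have := hnum i hi
    positivity
  · have := hden i hi
    rw [div_mul_eq_mul_div, div_mul_eq_mul_div]
    refine div_le_div_of_nonneg_right ?_ this.le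
    have hik : i + 1 ≤ h := by have := Finset.mem_range.1 hi; omega
    have h1 : q ^ i ≤ q ^ h / q := by
      rw [le_div_iff₀ (by positivity), ← pow_succ]
      exact pow_le_pow_right₀ hq.le hik
    have h2 : 0 < q ^ i := by positivity
    calc (q ^ (h + p) - q ^ i) * (1 - 1 / q) ≤ q ^ (h + p) * (1 - 1 / q) := by
          gcongr
          linarith
      _ = (q ^ h - q ^ h / q) * q ^ p := by rw [pow_add]; ring
      _ ≤ _ := by gcongr

theorem gaussBinom_mul_le_gaussBinom_mul_pow {q : ℝ} (hq : 1 < q) (m p j : ℕ) :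
    gaussBinom q (m + j + p) (m + j) * (1 - 1 / (q ^ m * (q - 1))) ≤
      gaussBinom q (m + p) m * q ^ (p * j) := by
  have hq1 : 0 < q - 1 := sub_pos.2 hq
  have key : gaussBinom q (m + j + p) (m + j) *
      (1 - 1 / (q ^ m * (q - 1)) + 1 / (q ^ (m + j) * (q - 1))) ≤
      gaussBinom q (m + p) m * q ^ (p * j) := by
    induction j with
    | zero => simp
    | succ j ih =>
      set u := 1 - 1 / (q ^ m * (q - 1)) + 1 / (q ^ (m + j) * (q - 1)) with hu
      set x := 1 / q ^ (m + j + 1) with hx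
      have hx1 : 0 < 1 - x := by
        rw [hx, sub_pos, div_lt_one (by positivity)]
        exact one_lt_pow₀ hq (by omega)
      have hx0 : 0 < x := by positivity
      have hu1 : u ≤ 1 := by
        have : 1 / (q ^ (m + j) * (q - 1)) ≤ 1 / (q ^ m * (q - 1)) := by
          gcongr
          · exact hq.le
          · omega
        linarith
      have hsucc : 1 - 1 / (q ^ m * (q - 1)) + 1 / (q ^ (m + (j + 1)) * (q - 1)) = u - x := by
        rw [hu, hx, ← add_assoc, pow_succ]
        field_simp
        ring
      rw [hsucc]
      have hle : u - x ≤ u * (1 - x) := by nlinarith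
      have hg := gaussBinom_succ_succ hq (m + j + p) (m + j)
      have hpos := gaussBinom_pos hq (show m + j ≤ m + j + p by omega)
      have hpos' := gaussBinom_pos hq (show m + j + 1 ≤ m + j + p + 1 by omega)
      have hstep : gaussBinom q (m + j + p + 1) (m + j + 1) * (1 - x) ≤
          gaussBinom q (m + j + p) (m + j) * q ^ p := by
        have hX : 0 < q ^ (m + j + 1) := by positivity
        have e1 : (1 - x) = (q ^ (m + j + 1) - 1) / q ^ (m + j + 1) := by
          rw [hx]
          field_simp
        rw [e1, ← mul_div_assoc, hg, div_le_iff₀ hX, mul_assoc, ← pow_add]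
        gcongr
        rw [show m + j + p + 1 = p + (m + j + 1) by omega]
        linarith
      have e2 : m + (j + 1) + p = m + j + p + 1 := by omega
      rw [e2, ← add_assoc]
      by_cases hu0 : 0 ≤ u
      · calc _ ≤ gaussBinom q (m + j + p + 1) (m + j + 1) * (u * (1 - x)) := by gcongr
          _ = gaussBinom q (m + j + p + 1) (m + j + 1) * (1 - x) * u := by ring
          _ ≤ gaussBinom q (m + j + p) (m + j) * q ^ p * u := by gcongr
          _ = gaussBinom q (m + j + p) (m + j) * u * q ^ p := by ring
          _ ≤ gaussBinom q (m + p) m * q ^ (p * j) * q ^ p := by gcongr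
          _ = _ := by ring
      · have h0 : 0 < gaussBinom q (m + p) m := gaussBinom_pos hq (by omega)
        have h1 : gaussBinom q (m + j + p + 1) (m + j + 1) * (u - x) ≤ 0 :=
          mul_nonpos_of_nonneg_of_nonpos hpos'.le (by linarith)
        exact h1.trans (by positivity)
  refine le_trans ?_ key
  have := gaussBinom_pos hq (show m + j ≤ m + j + p by omega)
  gcongr
  have : 0 < 1 / (q ^ (m + j) * (q - 1)) := by positivity
  linarith

theorem le_rich_of_variance_bound {q a N A D c M Q η E : ℝ} {m k p h : ℕ} (hq : 1 < q)
    (ha : 0 < a)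
    (hp : 1 ≤ p) (hh : h = m + 2 * k + 1)
    (hN : N = gaussBinom q (h + p) k * q ^ (h + p)) (hA : A = gaussBinom q h k * q ^ h)
    (hD : D = gaussBinom q (m + k + 1 + p) (m + k + 1)) (hc : c = gaussBinom q (m + p) m)
    (hη : η = 1 - 1 / q) (hη2 : 1 ≤ 2 * η ^ k) (hE : E = q ^ ((p - 1) * (m + k + 1) + k))
    (hQ : 0 ≤ Q) (hM : 0 ≤ M) (hMQ : M + Q = N)
    (hvar : a ≤ 2 * a * q ^ (p * (k + 1)) * A / N →
      (2 * a * q ^ (p * (k + 1)) * A / N - a) ^ 2 * Q ≤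
      2 * a * q ^ (p * (k + 1)) * (D * A - N * c) * M / N) :
    (2 * η ^ k - 1) ^ 2 * η ^ (m + k + 2) * (a / (a + 2 * E)) * N ≤ M := by
  have hq0 : 0 < q := by linarith
  have hη0 : 0 < η := hη ▸ sub_pos.2 ((div_lt_one hq0).2 hq)
  have hη1 : η ≤ 1 := by
    have : 0 < 1 / q := by positivity
    linarith
  have hgN := gaussBinom_pos hq (show k ≤ h + p by omega)
  have hgA := gaussBinom_pos hq (show k ≤ h by omega)
  have hDpos : 0 < D := hD ▸ gaussBinom_pos hq (by omega)
  have hcpos : 0 < c := hc ▸ gaussBinom_pos hq (by omega)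
  have hN0 : 0 < N := by rw [hN]; positivity
  have hA0 : 0 < A := by rw [hA]; positivity
  have hE0 : 0 < E := by rw [hE]; positivity
  have hNA : q ^ (p * (k + 1)) * A ≤ N := by
    have := gaussBinom_mul_pow_le hq (show k ≤ h by omega) p
    calc q ^ (p * (k + 1)) * A = gaussBinom q h k * q ^ (p * k) * q ^ (h + p) := by
          rw [hA]; ring
      _ ≤ N := by rw [hN]; gcongr
  have hAN : η ^ k * N ≤ q ^ (p * (k + 1)) * A := by
    have := gaussBinom_le_mul_pow hq (show k ≤ h by omega) p
    rw [← hη] at this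
    calc η ^ k * N = gaussBinom q (h + p) k * η ^ k * q ^ (h + p) := by rw [hN]; ring
      _ ≤ gaussBinom q h k * q ^ (p * k) * q ^ (h + p) := by gcongr
      _ = _ := by rw [hA]; ring
  set s := 1 / (q ^ m * (q - 1)) with hs
  have hs0 : 0 < s := by
    have : 0 < q - 1 := by linarith
    positivity
  have hcD : D * (1 - s) ≤ c * q ^ (p * (k + 1)) := by
    rw [hD, hc]
    exact gaussBinom_mul_le_gaussBinom_mul_pow hq m p (k + 1)
  have hR : D * A - N * c ≤ D * A * s := by
    have h1 : D * (1 - s) * A ≤ c * q ^ (p * (k + 1)) * A := by gcongr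
    have h2 : c * (q ^ (p * (k + 1)) * A) ≤ c * N := by gcongr
    nlinarith
  have hDE : D * s * η ^ (m + k + 2) ≤ E := by
    have h1 := gaussBinom_le_mul_pow hq (le_refl (m + k + 1)) p
    rw [← hη, ← hD, gaussBinom_self hq, one_mul] at h1
    have h2 : s * η * q ^ (p * (m + k + 1)) = E := by
      obtain ⟨r, rfl⟩ := Nat.exists_eq_add_of_le' hp
      have hq1 : q - 1 ≠ 0 := by linarith
      rw [hE, hs, hη, Nat.add_sub_cancel]
      rw [show (r + 1) * (m + k + 1) = r * (m + k + 1) + k + m + 1 by ring]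
      field_simp
      ring
    calc D * s * η ^ (m + k + 2) = s * η * (D * η ^ (m + k + 1)) := by ring
      _ ≤ s * η * q ^ (p * (m + k + 1)) := by gcongr
      _ = E := h2
  set μ := 2 * a * q ^ (p * (k + 1)) * A / N with hμ
  have hμ1 : 2 * a * η ^ k ≤ μ := by
    rw [hμ, le_div_iff₀ hN0]
    calc 2 * a * η ^ k * N = 2 * a * (η ^ k * N) := by ring
      _ ≤ 2 * a * (q ^ (p * (k + 1)) * A) := by gcongr
      _ = _ := by ring
  have hμ2 : μ ≤ 2 * a := by
    rw [hμ, div_le_iff₀ hN0]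
    calc _ = 2 * a * (q ^ (p * (k + 1)) * A) := by ring
      _ ≤ _ := by gcongr
  have hμa : a * (2 * η ^ k - 1) ≤ μ - a := by linarith
  have hw : 0 ≤ 2 * η ^ k - 1 := by linarith
  have hv := hvar (by nlinarith)
  have hmain : a * ((2 * η ^ k - 1) ^ 2 * Q) ≤ 2 * (D * s) * M := by
    refine le_of_mul_le_mul_left ?_ ha
    calc a * (a * ((2 * η ^ k - 1) ^ 2 * Q)) = (a * (2 * η ^ k - 1)) ^ 2 * Q := by ring
      _ ≤ (μ - a) ^ 2 * Q := by gcongr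
      _ ≤ 2 * a * q ^ (p * (k + 1)) * (D * A - N * c) * M / N := hv
      _ ≤ 2 * a * q ^ (p * (k + 1)) * (D * A * s) * M / N := by gcongr
      _ = μ * (D * s * M) := by rw [hμ]; ring
      _ ≤ 2 * a * (D * s * M) := by gcongr
      _ = a * (2 * (D * s) * M) := by ring
  set θ := (2 * η ^ k - 1) ^ 2 * η ^ (m + k + 2) with hθ
  have hθ0 : 0 ≤ θ := by positivity
  have hθ1 : θ ≤ 1 := by
    have h1 : η ^ k ≤ 1 := pow_le_one₀ hη0.le hη1
    exact mul_le_one₀ (pow_le_one₀ hw (by linarith)) (by positivity) (pow_le_one₀ hη0.le hη1)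
  have hfin : a * θ * Q ≤ 2 * E * M := by
    calc a * θ * Q = a * ((2 * η ^ k - 1) ^ 2 * Q) * η ^ (m + k + 2) := by rw [hθ]; ring
      _ ≤ 2 * (D * s) * M * η ^ (m + k + 2) := by gcongr
      _ = 2 * (D * s * η ^ (m + k + 2)) * M := by ring
      _ ≤ _ := by gcongr
  rw [mul_assoc, div_mul_eq_mul_div, ← mul_div_assoc, div_le_iff₀ (by positivity), ← hMQ]
  nlinarith [mul_nonneg (mul_nonneg ha.le hM) (sub_nonneg.2 hθ1)]

section Counting

variable {F V : Type*} [Field F] [Fintype F] [AddCommGroup V] [Module F V] [Finite V]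

theorem card_submodule_finrank_eq {r : ℕ} (hr : r ≤ Module.finrank F V) :
    (Nat.card {W : Submodule F V // Module.finrank F W = r} : ℝ) =
      gaussBinom (Fintype.card F) (Module.finrank F V) r := by
  classical
  have hq : (1 : ℝ) < Fintype.card F := by exact_mod_cast Fintype.one_lt_card
  have := Fintype.ofFinite {W : Submodule F V // Module.finrank F W = r}
  obtain ⟨φ, hφ_apply⟩ : ∃ φ : (Σ W : {W : Submodule F V // Module.finrank F W = r},
      {s : Fin r → W.1 // LinearIndependent F s}) → {s : Fin r → V // LinearIndependent F s},
      ∀ p i, (φ p).1 i = p.2.1 i :=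
    ⟨fun p => ⟨fun i => (p.2.1 i : V), p.2.2.map' p.1.1.subtype (Submodule.ker_subtype _)⟩,
      fun _ _ => rfl⟩
  have hspan : ∀ p, Submodule.span F (Set.range (φ p).1) = p.1.1 := by
    intro p
    refine Submodule.eq_of_le_of_finrank_eq ?_ ?_
    · rw [Submodule.span_le]
      rintro _ ⟨i, rfl⟩
      rw [hφ_apply]
      exact (p.2.1 i).2
    · rw [finrank_span_eq_card (φ p).2, Fintype.card_fin, p.1.2]
  have hφ : Function.Bijective φ := by
    constructor
    · rintro ⟨⟨W, hW⟩, s⟩ ⟨⟨W', hW'⟩, s'⟩ heq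
      have h1 := hspan ⟨⟨W, hW⟩, s⟩
      rw [heq, hspan ⟨⟨W', hW'⟩, s'⟩] at h1
      subst h1
      congr 1
      ext i
      have h2 := hφ_apply ⟨⟨W', hW⟩, s⟩ i
      rw [heq, hφ_apply] at h2
      exact h2.symm
    · intro s
      refine ⟨⟨⟨Submodule.span F (Set.range s.1), ?_⟩,
        ⟨fun i => ⟨s.1 i, Submodule.subset_span ⟨i, rfl⟩⟩, ?_⟩⟩,
        Subtype.ext (funext fun i => hφ_apply _ i)⟩
      · rw [finrank_span_eq_card s.2, Fintype.card_fin]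
      · exact LinearIndependent.of_comp (Submodule.subtype _) s.2
  have hcard := Nat.card_eq_of_bijective φ hφ
  rw [Nat.card_sigma, card_linearIndependent hr] at hcard
  have hW : ∀ W : {W : Submodule F V // Module.finrank F W = r},
      Nat.card {s : Fin r → W.1 // LinearIndependent F s} =
        ∏ i : Fin r, (Fintype.card F ^ r - Fintype.card F ^ i.val) := fun W => by
    rw [card_linearIndependent W.2.ge, W.2]
  simp only [hW, Finset.sum_const, Finset.card_univ, smul_eq_mul,
    ← Nat.card_eq_fintype_card] at hcard
  have hcast : ∀ n, r ≤ n →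
      ((∏ i : Fin r, (Fintype.card F ^ n - Fintype.card F ^ i.val) : ℕ) : ℝ) =
        ∏ i ∈ Finset.range r, ((Fintype.card F : ℝ) ^ n - (Fintype.card F : ℝ) ^ i) := by
    intro n hn
    rw [Finset.prod_range, Nat.cast_prod]
    refine Finset.prod_congr rfl fun i _ => ?_
    rw [Nat.cast_sub (Nat.pow_le_pow_right Fintype.card_pos (by omega))]
    push_cast
    rfl
  have hcard' := congrArg (Nat.cast (R := ℝ)) hcard
  rw [Nat.card_eq_fintype_card] at hcard' ⊢
  rw [Nat.cast_mul, Nat.card_eq_fintype_card, hcast _ le_rfl, hcast _ hr] at hcard'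
  rw [gaussBinom, Finset.prod_div_distrib, eq_div_iff, hcard']
  refine Finset.prod_ne_zero_iff.2 fun i hi => ?_
  exact (sub_pos.2 (pow_lt_pow_right₀ hq (Finset.mem_range.1 hi))).ne'

theorem card_submodule_le_finrank_eq (U : Submodule F V) {r : ℕ} (hr : r ≤ Module.finrank F U) :
    (Nat.card {W : Submodule F V // Module.finrank F W = r ∧ W ≤ U} : ℝ) =
      gaussBinom (Fintype.card F) (Module.finrank F U) r := by
  rw [← card_submodule_finrank_eq hr]
  congr 1
  refine (Nat.card_eq_of_bijective
    (fun W : {W : Submodule F U // Module.finrank F W = r} =>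
      (⟨W.1.map U.subtype, (Submodule.finrank_map_subtype_eq U W.1).trans W.2,
        Submodule.map_subtype_le U W.1⟩ :
        {W : Submodule F V // Module.finrank F W = r ∧ W ≤ U})) ⟨?_, ?_⟩).symm
  · intro W W' heq
    exact Subtype.ext (Submodule.map_injective_of_injective U.injective_subtype
      (congrArg Subtype.val heq))
  · rintro ⟨W, hW, hWU⟩
    have h1 : (W.comap U.subtype).map U.subtype = W := by
      rw [Submodule.map_comap_subtype, inf_of_le_right hWU]
    refine ⟨⟨W.comap U.subtype, ?_⟩, Subtype.ext h1⟩
    rw [← Submodule.finrank_map_subtype_eq, h1, hW]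

theorem card_submodule_ge_finrank_eq (Z : Submodule F V) {z r p : ℕ}
    (hZ : Module.finrank F Z = z) (hV : Module.finrank F V = z + r + p) :
    (Nat.card {U : Submodule F V // Module.finrank F U = z + r ∧ Z ≤ U} : ℝ) =
      gaussBinom (Fintype.card F) (r + p) r := by
  have hVZ : Module.finrank F (V ⧸ Z) = r + p := by
    have := Z.finrank_quotient_add_finrank
    omega
  have : Finite (V ⧸ Z) := Finite.of_surjective Z.mkQ Z.mkQ_surjective
  rw [← hVZ, ← card_submodule_finrank_eq (by omega)]
  congr 1
  have hdim : ∀ U : Submodule F V, Z ≤ U →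
      (Module.finrank F (U.map Z.mkQ) = r ↔ Module.finrank F U = z + r) := by
    intro U hU
    have h1 := (Submodule.quotientQuotientEquivQuotient Z U hU).finrank_eq
    have h2 := (U.map Z.mkQ).finrank_quotient_add_finrank
    have h3 := U.finrank_quotient_add_finrank
    omega
  refine Nat.card_eq_of_bijective
    (fun U : {U : Submodule F V // Module.finrank F U = z + r ∧ Z ≤ U} =>
      (⟨U.1.map Z.mkQ, (hdim U.1 U.2.2).2 U.2.1⟩ :
        {W : Submodule F (V ⧸ Z) // Module.finrank F W = r})) ⟨?_, ?_⟩
  · rintro ⟨U, hU, hZU⟩ ⟨U', hU', hZU'⟩ heq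
    have h1 : U.map Z.mkQ = U'.map Z.mkQ := congrArg Subtype.val heq
    have h2 := congrArg (Submodule.comap Z.mkQ) h1
    rw [Submodule.comap_map_mkQ, Submodule.comap_map_mkQ, sup_eq_right.2 hZU,
      sup_eq_right.2 hZU'] at h2
    exact Subtype.ext h2
  · rintro ⟨W, hW⟩
    have h1 : (W.comap Z.mkQ).map Z.mkQ = W :=
      Submodule.map_comap_eq_of_surjective Z.mkQ_surjective W
    have h2 : Z ≤ W.comap Z.mkQ := by
      simpa using Submodule.comap_mono (f := Z.mkQ) (bot_le (a := W))
    exact ⟨⟨W.comap Z.mkQ, (hdim _ h2).1 (by rw [h1, hW]), h2⟩, Subtype.ext h1⟩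

theorem exists_submodule_ge_finrank_eq (Z : Submodule F V) {n : ℕ} (hZ : Module.finrank F Z ≤ n)
    (hn : n ≤ Module.finrank F V) : ∃ U : Submodule F V, Z ≤ U ∧ Module.finrank F U = n := by
  obtain ⟨r, rfl⟩ := Nat.exists_eq_add_of_le hZ
  obtain ⟨p, hp⟩ := Nat.exists_eq_add_of_le hn
  have h1 := card_submodule_ge_finrank_eq Z rfl hp
  have hq : (1 : ℝ) < Fintype.card F := by exact_mod_cast Fintype.one_lt_card
  have h2 := gaussBinom_pos hq (show r ≤ r + p by omega)
  rw [← h1, Nat.cast_pos, Nat.card_pos_iff] at h2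
  obtain ⟨⟨U, hU, hZU⟩⟩ := h2.1
  exact ⟨U, hZU, hU⟩

end Counting

theorem sum_ite_subtype_eq_card {α : Type*} [Finite α] (p r : α → Prop) [Fintype {w // p w}]
    [∀ w : {w // p w}, Decidable (r w)] :
    (∑ w : {w // p w}, if r w then (1 : ℝ) else 0) = Nat.card {w // p w ∧ r w} := by
  rw [Finset.sum_boole, ← Fintype.card_subtype, ← Nat.card_eq_fintype_card]
  exact congrArg _ (Nat.card_congr (Equiv.subtypeSubtypeEquivSubtypeInter p r))

section Cosets

variable {F V : Type*} [Field F] [AddCommGroup V] [Module F V]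

theorem mem_vadd_submodule {W : Submodule F V} {x z : V} :
    z ∈ x +ᵥ (W : Set V) ↔ z - x ∈ W := by
  rw [Set.mem_vadd_set_iff_neg_vadd_mem, vadd_eq_add, SetLike.mem_coe, neg_add_eq_sub]

theorem vadd_submodule_subset_iff {W U : Submodule F V} {x y : V} :
    x +ᵥ (W : Set V) ⊆ y +ᵥ (U : Set V) ↔ W ≤ U ∧ x ∈ y +ᵥ (U : Set V) := by
  constructor
  · intro h
    have hx : x ∈ y +ᵥ (U : Set V) := h (mem_vadd_submodule.2 (by simp))
    refine ⟨fun w hw => ?_, hx⟩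
    have h1 : x + w ∈ y +ᵥ (U : Set V) := h (mem_vadd_submodule.2 (by simpa using hw))
    rw [mem_vadd_submodule] at h1 hx
    simpa using U.sub_mem h1 hx
  · rintro ⟨hWU, hx⟩ z hz
    rw [mem_vadd_submodule] at *
    simpa using U.add_mem (hWU hz) hx

theorem self_mem_vadd_submodule (W : Submodule F V) (x : V) : x ∈ x +ᵥ (W : Set V) :=
  mem_vadd_submodule.2 (by simp)

theorem vadd_submodule_eq_of_mem {W : Submodule F V} {x y : V} (h : x ∈ y +ᵥ (W : Set V)) :
    x +ᵥ (W : Set V) = y +ᵥ (W : Set V) := by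
  refine (vadd_submodule_subset_iff.2 ⟨le_rfl, h⟩).antisymm
    (vadd_submodule_subset_iff.2 ⟨le_rfl, ?_⟩)
  rw [mem_vadd_submodule] at *
  simpa using W.neg_mem h

theorem eq_of_vadd_submodule_eq {W U : Submodule F V} {x y : V}
    (h : x +ᵥ (W : Set V) = y +ᵥ (U : Set V)) : W = U :=
  (vadd_submodule_subset_iff.1 h.subset).1.antisymm (vadd_submodule_subset_iff.1 h.superset).1

theorem card_vadd_submodule [Fintype F] [Finite V] (W : Submodule F V) (x : V) :
    Nat.card {z // z ∈ x +ᵥ (W : Set V)} = Fintype.card F ^ Module.finrank F W := by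
  rw [Nat.card_congr (β := W), Module.natCard_eq_pow_finrank (K := F), Nat.card_eq_fintype_card]
  exact ⟨fun z => ⟨z - x, mem_vadd_submodule.1 z.2⟩,
    fun w => ⟨w + x, mem_vadd_submodule.2 (by simp)⟩, fun z => by simp, fun w => by simp⟩

end Cosets

section AffinePlanes

variable {F : Type} [Field F] [Fintype F] {d k h : ℕ}

open Classical in
/-- The indicator that the coset `x + W` is contained in the affine plane `H`. -/
noncomputable def cosetIncidence (F : Type) [Field F] (d k h : ℕ)
    (x : {W : Submodule F (Fin d → F) // Module.finrank F W = k} × (Fin d → F))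
    (H : {H : Set (Fin d → F) // IsAffinePlane F d h H}) : ℝ :=
  if x.2 +ᵥ (x.1.1 : Set (Fin d → F)) ⊆ H.1 then 1 else 0

open Classical in
theorem sum_cosetIncidence_left (hkh : k ≤ h)
    (H : {H : Set (Fin d → F) // IsAffinePlane F d h H}) :
    ∑ x, cosetIncidence F d k h x H =
      gaussBinom (Fintype.card F) h k * (Fintype.card F : ℝ) ^ h := by
  obtain ⟨_, U, y, hU, rfl⟩ := H
  simp only [cosetIncidence, vadd_submodule_subset_iff, ite_and, Fintype.sum_prod_type]
  have h1 : ∀ (W : Submodule F (Fin d → F)) (x : Fin d → F),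
      (if W ≤ U then (if x ∈ y +ᵥ (U : Set (Fin d → F)) then (1 : ℝ) else 0) else 0) =
      (if W ≤ U then 1 else 0) * (if x ∈ y +ᵥ (U : Set (Fin d → F)) then 1 else 0) := by
    intro W x
    split_ifs <;> simp
  simp only [h1, ← Finset.mul_sum, ← Finset.sum_mul]
  rw [sum_ite_subtype_eq_card (fun W : Submodule F (Fin d → F) => Module.finrank F W = k)
    (fun W => W ≤ U), card_submodule_le_finrank_eq U (by omega), Finset.sum_boole,
    ← Fintype.card_subtype, ← Nat.card_eq_fintype_card (α := {x // x ∈ _}),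
    card_vadd_submodule, hU]
  push_cast
  rfl

open Classical in
theorem sum_cosetIncidence_right {p m : ℕ} (hh : h = k + m) (hd : d = h + p)
    (x : {W : Submodule F (Fin d → F) // Module.finrank F W = k} × (Fin d → F)) :
    ∑ H, cosetIncidence F d k h x H = gaussBinom (Fintype.card F) (m + p) m := by
  obtain ⟨⟨W, hW⟩, x⟩ := x
  rw [← card_submodule_ge_finrank_eq W hW (by simp; omega)]
  unfold cosetIncidence
  rw [sum_ite_subtype_eq_card (fun H => IsAffinePlane F d h H)
    (fun H => x +ᵥ (W : Set (Fin d → F)) ⊆ H)]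
  congr 1
  refine (Nat.card_eq_of_bijective
    (fun U : {U : Submodule F (Fin d → F) // Module.finrank F U = k + m ∧ W ≤ U} =>
      (⟨x +ᵥ (U.1 : Set (Fin d → F)), ⟨U.1, x, by rw [U.2.1, hh], rfl⟩,
        vadd_submodule_subset_iff.2 ⟨U.2.2, self_mem_vadd_submodule _ _⟩⟩ :
        {H // IsAffinePlane F d h H ∧ x +ᵥ (W : Set (Fin d → F)) ⊆ H})) ⟨?_, ?_⟩).symm
  · intro U U' heq
    exact Subtype.ext (eq_of_vadd_submodule_eq (congrArg Subtype.val heq))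
  · rintro ⟨_, ⟨U, y, hU, rfl⟩, hsub⟩
    have := vadd_submodule_subset_iff.1 hsub
    exact ⟨⟨U, by rw [hU, hh], this.1⟩, Subtype.ext (vadd_submodule_eq_of_mem this.2)⟩

open Classical in
theorem le_sum_cosetIncidence_mul {p m : ℕ} (hh : h = m + 2 * k + 1) (hd : d = h + p)
    (x x' : {W : Submodule F (Fin d → F) // Module.finrank F W = k} × (Fin d → F)) :
    gaussBinom (Fintype.card F) (m + p) m ≤
      ∑ H, cosetIncidence F d k h x H * cosetIncidence F d k h x' H := by
  obtain ⟨⟨W, hW⟩, x⟩ := x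
  obtain ⟨⟨W', hW'⟩, x'⟩ := x'
  obtain ⟨Z, hZ, hZr⟩ := exists_submodule_ge_finrank_eq
    (W ⊔ W' ⊔ Submodule.span F {x' - x}) (n := 2 * k + 1) (by
      have h1 := Submodule.finrank_add_le_finrank_add_finrank W W'
      have h2 := Submodule.finrank_add_le_finrank_add_finrank (W ⊔ W')
        (Submodule.span F {x' - x})
      have h3 := finrank_span_le_card (R := F) ({x' - x} : Set (Fin d → F))
      simp only [Set.toFinset_singleton, Finset.card_singleton] at h3
      omega) (by simp; omega)
  simp only [sup_le_iff, Submodule.span_singleton_le_iff_mem] at hZ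
  rw [← card_submodule_ge_finrank_eq Z hZr (by simp; omega)]
  have h1 : ∀ H, cosetIncidence F d k h (⟨W, hW⟩, x) H * cosetIncidence F d k h (⟨W', hW'⟩, x') H =
      if x +ᵥ (W : Set (Fin d → F)) ⊆ H.1 ∧ x' +ᵥ (W' : Set (Fin d → F)) ⊆ H.1
        then 1 else 0 := by
    intro H
    simp only [cosetIncidence, ite_and]
    split_ifs <;> simp
  simp only [h1]
  rw [sum_ite_subtype_eq_card (fun H => IsAffinePlane F d h H)
    (fun H => x +ᵥ (W : Set (Fin d → F)) ⊆ H ∧ x' +ᵥ (W' : Set (Fin d → F)) ⊆ H), Nat.cast_le]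
  refine Nat.card_le_card_of_injective
    (fun U : {U : Submodule F (Fin d → F) // Module.finrank F U = 2 * k + 1 + m ∧ Z ≤ U} =>
      (⟨x +ᵥ (U.1 : Set (Fin d → F)), ⟨U.1, x, by rw [U.2.1]; omega, rfl⟩,
        vadd_submodule_subset_iff.2 ⟨hZ.1.1.trans U.2.2, self_mem_vadd_submodule _ _⟩,
        vadd_submodule_subset_iff.2 ⟨hZ.1.2.trans U.2.2,
          mem_vadd_submodule.2 (U.2.2 hZ.2)⟩⟩ :
        {H // IsAffinePlane F d h H ∧ x +ᵥ (W : Set (Fin d → F)) ⊆ H ∧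
          x' +ᵥ (W' : Set (Fin d → F)) ⊆ H})) ?_
  intro U U' heq
  exact Subtype.ext (eq_of_vadd_submodule_eq (congrArg Subtype.val heq))

open Classical in
theorem card_coset_filter_le (P : Set (Fin d → F) → Prop) :
    #{x : {W : Submodule F (Fin d → F) // Module.finrank F W = k} × (Fin d → F) |
        P (x.2 +ᵥ (x.1.1 : Set (Fin d → F)))} ≤
      Fintype.card F ^ k * Nat.card {S : Set (Fin d → F) | IsAffinePlane F d k S ∧ P S} := by
  set s : Finset ({W : Submodule F (Fin d → F) // Module.finrank F W = k} × (Fin d → F)) :=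
    {x | P (x.2 +ᵥ (x.1.1 : Set (Fin d → F)))} with hs
  refine (Finset.card_le_mul_card_image
    (f := fun x => x.2 +ᵥ (x.1.1 : Set (Fin d → F))) s (Fintype.card F ^ k) ?_).trans ?_
  · intro S hS
    obtain ⟨⟨⟨W, hW⟩, y⟩, -, rfl⟩ := Finset.mem_image.1 hS
    calc _ ≤ #{z | z ∈ y +ᵥ (W : Set (Fin d → F))} := by
          refine Finset.card_le_card_of_injOn Prod.snd ?_ ?_
          · rintro ⟨W', y'⟩ h'
            have h' := (Finset.mem_filter.1 h').2
            simp only at h'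
            simp only [Finset.coe_filter, Finset.mem_univ, true_and, Set.mem_ofPred_eq]
            rw [← h']
            exact self_mem_vadd_submodule _ _
          · rintro ⟨W₁, y₁⟩ h₁ ⟨W₂, y₂⟩ h₂ heq
            have h₁ := (Finset.mem_filter.1 h₁).2
            have h₂ := (Finset.mem_filter.1 h₂).2
            exact Prod.ext (Subtype.ext (eq_of_vadd_submodule_eq (h₁.trans h₂.symm))) heq
      _ = Fintype.card F ^ k := by
          rw [← Fintype.card_subtype, ← Nat.card_eq_fintype_card, card_vadd_submodule, hW]
  · refine Nat.mul_le_mul_left _ ?_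
    rw [Nat.card_coe_set_eq, ← Set.ncard_coe_finset]
    refine Set.ncard_le_ncard ?_ (Set.toFinite _)
    intro S hS
    obtain ⟨⟨⟨W, hW⟩, y⟩, hx, rfl⟩ := Finset.mem_image.1 (Finset.mem_coe.1 hS)
    exact ⟨⟨W, y, hW, rfl⟩, (Finset.mem_filter.1 hx).2⟩

open Classical in
theorem rich_planes_lower_bound {p m t : ℕ} (hh : h = m + 2 * k + 1) (hd : d = h + p)
    (hp : 1 ≤ p) (ht : 2 ≤ t) (Hs : Finset (Set (Fin d → F)))
    (hHs : ∀ H ∈ Hs, IsAffinePlane F d h H)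
    (hcard : 2 * (t - 1) * Fintype.card F ^ (p * (k + 1)) ≤ #Hs) {η : ℝ}
    (hη : η = 1 - 1 / Fintype.card F) (hη2 : 1 ≤ 2 * η ^ k) :
    (2 * η ^ k - 1) ^ 2 * η ^ (m + k + 2) *
        (((t : ℝ) - 1) / (((t : ℝ) - 1) +
          2 * (Fintype.card F : ℝ) ^ ((p - 1) * (m + k + 1) + k))) *
        (Fintype.card F : ℝ) ^ ((d - k) * (k + 1)) ≤
      (Nat.card {S : Set (Fin d → F) |
        IsAffinePlane F d k S ∧ t ≤ #{H ∈ Hs | S ⊆ H}} : ℝ) := by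
  have hq : (1 : ℝ) < Fintype.card F := by exact_mod_cast Fintype.one_lt_card
  obtain ⟨Hs', hsub, hcard'⟩ := Finset.exists_subset_card_eq hcard
  have hHs' : ∀ H ∈ Hs', IsAffinePlane F d h H := fun H hH => hHs H (hsub hH)
  set B : Finset {H : Set (Fin d → F) // IsAffinePlane F d h H} :=
    Hs'.subtype (fun H => IsAffinePlane F d h H)
  have hBcard : (#B : ℝ) = 2 * ((t : ℝ) - 1) * (Fintype.card F : ℝ) ^ (p * (k + 1)) := by
    rw [Finset.card_subtype, Finset.filter_true_of_mem hHs', hcard']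
    push_cast [Nat.cast_sub (show 1 ≤ t by omega)]
    ring
  have hBsum : ∀ x : {W : Submodule F (Fin d → F) // Module.finrank F W = k} × (Fin d → F),
      ∑ H ∈ B, cosetIncidence F d k h x H =
        #{H ∈ Hs' | x.2 +ᵥ (x.1.1 : Set (Fin d → F)) ⊆ H} := by
    intro x
    rw [← Finset.sum_boole]
    exact Finset.sum_subtype_of_mem
      (fun H => if x.2 +ᵥ (x.1.1 : Set (Fin d → F)) ⊆ H then (1 : ℝ) else 0) hHs'
  set X := {W : Submodule F (Fin d → F) // Module.finrank F W = k} × (Fin d → F)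
  have hX : (Fintype.card X : ℝ) =
      gaussBinom (Fintype.card F) (h + p) k * (Fintype.card F : ℝ) ^ (h + p) := by
    have := card_submodule_finrank_eq (F := F) (V := Fin d → F) (r := k) (by simp; omega)
    rw [Nat.card_eq_fintype_card] at this
    rw [Fintype.card_prod, Nat.cast_mul, this]
    simp [hd]
  have hXpos : (0 : ℝ) < Fintype.card X := by
    rw [hX]
    have := gaussBinom_pos hq (show k ≤ h + p by omega)
    positivity
  have : Nonempty X := Fintype.card_pos_iff.1 (by exact_mod_cast hXpos)
  set R : Finset X := {x | t ≤ #{H ∈ Hs' | x.2 +ᵥ (x.1.1 : Set (Fin d → F)) ⊆ H}}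
  have hRQ : (#R : ℝ) + (#Rᶜ : ℝ) = Fintype.card X := by
    exact_mod_cast Finset.card_add_card_compl R
  have hvar := card_poor_le (cosetIncidence F d k h) (a := (t : ℝ) - 1)
    (sum_cosetIncidence_left (by omega))
    (sum_cosetIncidence_right (m := m + k + 1) (by omega) hd)
    (le_sum_cosetIncidence_mul hh hd) B Rᶜ (by
      intro x hx
      rw [hBsum, le_sub_iff_add_le]
      simp only [R, Finset.compl_filter, Finset.mem_filter, not_le] at hx
      exact_mod_cast hx.2)
  rw [hBcard, show (Fintype.card X : ℝ) - #Rᶜ = #R by linarith] at hvar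
  have hmain := le_rich_of_variance_bound hq (a := (t : ℝ) - 1)
    (by have : (2 : ℝ) ≤ t := by exact_mod_cast ht
        linarith)
    hp hh hX rfl rfl rfl hη hη2 rfl (Nat.cast_nonneg #Rᶜ) (Nat.cast_nonneg #R) hRQ hvar
  have hRle : (#R : ℝ) ≤ (Fintype.card F : ℝ) ^ k * (Nat.card {S : Set (Fin d → F) |
      IsAffinePlane F d k S ∧ t ≤ #{H ∈ Hs | S ⊆ H}} : ℝ) := by
    have h1 : #R ≤ Fintype.card F ^ k * Nat.card {S : Set (Fin d → F) |
        IsAffinePlane F d k S ∧ t ≤ #{H ∈ Hs' | S ⊆ H}} := by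
      convert card_coset_filter_le (F := F) (d := d) (k := k)
        (fun S => t ≤ #{H ∈ Hs' | S ⊆ H})
    have h2 : Nat.card {S : Set (Fin d → F) | IsAffinePlane F d k S ∧ t ≤ #{H ∈ Hs' | S ⊆ H}} ≤
        Nat.card {S : Set (Fin d → F) | IsAffinePlane F d k S ∧ t ≤ #{H ∈ Hs | S ⊆ H}} := by
      refine Nat.card_mono (Set.toFinite _) fun S hS => ⟨hS.1, hS.2.trans ?_⟩
      exact Finset.card_le_card (Finset.filter_subset_filter _ hsub)
    exact_mod_cast h1.trans (Nat.mul_le_mul_left _ h2)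
  have hXge : (Fintype.card F : ℝ) ^ k * (Fintype.card F : ℝ) ^ ((d - k) * (k + 1)) ≤
      Fintype.card X := by
    obtain ⟨r, hr⟩ : ∃ r, d = k + r := ⟨d - k, by omega⟩
    have h1 := gaussBinom_mul_pow_le hq (le_refl k) r
    rw [gaussBinom_self hq, one_mul] at h1
    rw [hX, ← hd, hr, Nat.add_sub_cancel_left]
    calc _ = (Fintype.card F : ℝ) ^ (r * k) * (Fintype.card F : ℝ) ^ (k + r) := by ring
      _ ≤ _ := by gcongr
  have hqk : 0 < (Fintype.card F : ℝ) ^ k := by positivity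
  refine le_of_mul_le_mul_left ?_ hqk
  refine le_trans ?_ (hmain.trans hRle)
  rw [mul_left_comm]
  have ht0 : (0 : ℝ) ≤ (t : ℝ) - 1 := by
    have : (2 : ℝ) ≤ t := by exact_mod_cast ht
    linarith
  have hη0 : 0 ≤ η := by
    rw [hη, sub_nonneg, div_le_one (by positivity)]
    exact hq.le
  gcongr

end AffinePlanes

end

open Classical in
/-- For `t ≥ 2` and `h ≥ 2k+1`, if `ℋ` is a set of h-planes of
`F_q^d` with `|ℋ| ≥ 2(t-1) q^{(d-h)(k+1)}`, then the number of k-planes contained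
in at least `t` of the h-planes of `ℋ` is at least `c q^{(d-k)(k+1)}` (up to a
`1 - ε` factor for `q` large), where `c = (t-1)/((t-1) + 2 q^{(d-h-1)(h-k)+k})`. -/
theorem rich_k_planes (d k h : ℕ) (hhk : 2 * k + 1 ≤ h) (hhd : h < d)
    (t : ℕ) (ht : 2 ≤ t) :
    ∀ ε : ℝ, 0 < ε → ∃ q₀ : ℕ,
      ∀ (F : Type) [Field F] [Fintype F],
        q₀ ≤ Fintype.card F → Odd (Fintype.card F) →
        ∀ Hs : Finset (Set (Fin d → F)),
          (∀ H ∈ Hs, IsAffinePlane F d h H) →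
          2 * (t - 1) * Fintype.card F ^ ((d - h) * (k + 1)) ≤ Hs.card →
          (1 - ε) *
              (((t : ℝ) - 1) /
                (((t : ℝ) - 1) +
                  2 * (Fintype.card F : ℝ) ^ ((d - h - 1) * (h - k) + k))) *
              (Fintype.card F : ℝ) ^ ((d - k) * (k + 1)) ≤
            (Nat.card {S : Set (Fin d → F) |
              IsAffinePlane F d k S ∧
                t ≤ (Hs.filter fun H => S ⊆ H).card} : ℝ) := by
  intro ε hε
  obtain ⟨m, rfl⟩ : ∃ m, h = m + 2 * k + 1 := ⟨h - (2 * k + 1), by omega⟩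
  have hlim : Filter.Tendsto (fun q : ℕ => 1 - 1 / (q : ℝ)) Filter.atTop (nhds 1) := by
    simpa using tendsto_const_nhds (x := (1 : ℝ)).sub (tendsto_one_div_atTop_nhds_zero_nat (𝕜 := ℝ))
  have hlim2 : Filter.Tendsto (fun q : ℕ => 2 * (1 - 1 / (q : ℝ)) ^ k) Filter.atTop (nhds 2) := by
    simpa using (hlim.pow k).const_mul 2
  have hlim3 : Filter.Tendsto (fun q : ℕ => (2 * (1 - 1 / (q : ℝ)) ^ k - 1) ^ 2 *
      (1 - 1 / (q : ℝ)) ^ (m + k + 2)) Filter.atTop (nhds 1) := by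
    have := ((hlim2.sub_const 1).pow 2).mul (hlim.pow (m + k + 2))
    norm_num at this
    simpa using this
  obtain ⟨q₀, hq₀⟩ := Filter.eventually_atTop.1
    ((hlim2.eventually (lt_mem_nhds (show (1 : ℝ) < 2 by norm_num))).and
      (hlim3.eventually (lt_mem_nhds (show 1 - ε < 1 by linarith))))
  refine ⟨q₀, fun F _ _ hq _ Hs hHs hcard => ?_⟩
  obtain ⟨h1, h2⟩ := hq₀ _ hq
  have key := rich_planes_lower_bound (F := F) (p := d - (m + 2 * k + 1)) (m := m) rfl
    (by omega) (by omega) ht Hs hHs hcard rfl h1.le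
  rw [show m + 2 * k + 1 - k = m + k + 1 by omega]
  refine le_trans ?_ key
  have ht0 : (0 : ℝ) ≤ (t : ℝ) - 1 := by
    have : (2 : ℝ) ≤ t := by exact_mod_cast ht
    linarith
  gcongr
end

section
/- For any integer t ≥ 2, let 𝒦 be a set of k-planes in F_q^d with |𝒦| ≥ 2(t−1)·q^{(d−h)(k+1)}, where h ≥ 2k+1. Then the number of h-planes containing at least t of the k-planes of 𝒦 is at least c·q^{(d−h)(h+1)}, where c = (t−1)/((t−1) + 2q^{k(h−k+1)}) (up to (1+o(1)) factors as q → ∞). -/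
open Pointwise

section Counting

open Classical Module Finset

variable {F E : Type*} [Field F] [Fintype F] [AddCommGroup E] [Module F E] [Fintype E]

theorem card_tuples_mem (m : ℕ) (A : Submodule F E) :
    #{ω : Fin m → E | ∀ i, ω i ∈ A} = Fintype.card F ^ (m * finrank F A) := by
  have h1 : ({ω : Fin m → E | ∀ i, ω i ∈ A} : Finset (Fin m → E)) =
      Fintype.piFinset (fun _ => ({x : E | x ∈ A} : Finset E)) := by
    ext ω; simp
  have h2 : #{x : E | x ∈ A} = Fintype.card F ^ finrank F A := by
    rw [← Module.card_eq_pow_finrank (K := F) (V := A), ← Fintype.card_subtype]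
  rw [h1, Fintype.card_piFinset]
  simp [h2, ← pow_mul, mul_comm]

theorem le_card_linearIndependent_mem (m : ℕ) (A : Submodule F E) (hm : m ≤ finrank F A) :
    (1 - (Fintype.card F : ℝ)⁻¹) ^ m * (Fintype.card F : ℝ) ^ (m * finrank F A) ≤
      #{ω : Fin m → E | LinearIndependent F ω ∧ ∀ i, ω i ∈ A} := by
  have hq : 1 < Fintype.card F := Fintype.one_lt_card
  have hq' : (0 : ℝ) < Fintype.card F := by positivity
  set n := finrank F A with hn
  have hcard : Nat.card {s : Fin m → A // LinearIndependent F s} ≤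
      #{ω : Fin m → E | LinearIndependent F ω ∧ ∀ i, ω i ∈ A} := by
    rw [Nat.card_eq_fintype_card, Fintype.card_subtype]
    refine card_le_card_of_injOn (fun s i => (s i : E)) ?_ ?_
    · intro s hs
      simp only [coe_filter, mem_univ, true_and, Set.mem_ofPred_eq] at hs ⊢
      exact ⟨hs.map' A.subtype A.ker_subtype, fun i => (s i).2⟩
    · intro s _ s' _ h
      funext i
      exact Subtype.ext (congrFun h i)
  rw [card_linearIndependent hm] at hcard
  refine le_trans ?_ (Nat.cast_le.mpr hcard)
  rw [pow_mul', ← mul_pow, Nat.cast_prod, ← Fin.prod_const]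
  refine Finset.prod_le_prod (fun i _ => ?_) (fun i _ => ?_)
  · have : (Fintype.card F : ℝ)⁻¹ ≤ 1 := inv_le_one_of_one_le₀ (by exact_mod_cast hq.le)
    have : 0 ≤ 1 - (Fintype.card F : ℝ)⁻¹ := by linarith
    positivity
  · have hi : (i : ℕ) + 1 ≤ n := by omega
    have hle : Fintype.card F ^ (i : ℕ) ≤ Fintype.card F ^ n :=
      Nat.pow_le_pow_right hq.le (by omega)
    rw [Nat.cast_sub hle]
    push_cast
    have h3 : (Fintype.card F : ℝ) ^ ((i : ℕ) + 1) ≤ (Fintype.card F : ℝ) ^ n :=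
      pow_le_pow_right₀ (by exact_mod_cast hq.le) hi
    have h4 : (Fintype.card F : ℝ) ^ (i : ℕ) ≤ (Fintype.card F : ℝ)⁻¹ * (Fintype.card F : ℝ) ^ n := by
      rw [inv_mul_eq_div, le_div_iff₀ hq', ← pow_succ]
      exact h3
    linarith

/-- A family of `n`-dimensional subspaces of a `D`-dimensional space over `F_q` has at most
`(1 - 1/q)^{-n} q^{n(D-n)}` members. -/
theorem card_submodules_le (n : ℕ) (C : Finset (Submodule F E)) (hC : ∀ A ∈ C, finrank F A = n) :
    #C * ((1 - (Fintype.card F : ℝ)⁻¹) ^ n * (Fintype.card F : ℝ) ^ (n * n)) ≤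
      (Fintype.card F : ℝ) ^ (n * finrank F E) := by
  have h1 : (#C : ℝ) * ((1 - (Fintype.card F : ℝ)⁻¹) ^ n * (Fintype.card F : ℝ) ^ (n * n)) ≤
      ∑ A ∈ C, (#{ω : Fin n → E | LinearIndependent F ω ∧ ∀ i, ω i ∈ A} : ℝ) := by
    rw [← nsmul_eq_mul, ← Finset.sum_const]
    refine sum_le_sum fun A hA => ?_
    have := le_card_linearIndependent_mem n A (hC A hA).ge
    rwa [hC A hA] at this
  refine h1.trans ?_
  rw [← Nat.cast_sum, ← card_biUnion]
  · have : Fintype.card (Fin n → E) = Fintype.card F ^ (n * finrank F E) := by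
      rw [Fintype.card_fun, Module.card_eq_pow_finrank (K := F) (V := E), Fintype.card_fin,
        ← pow_mul, mul_comm]
    calc _ ≤ ((Fintype.card (Fin n → E) : ℕ) : ℝ) := Nat.cast_le.mpr (card_le_univ _)
      _ = _ := by rw [this]; push_cast; rfl
  · intro A hA B hB hAB
    rw [Function.onFun, Finset.disjoint_left]
    rintro ω hω hω'
    simp only [mem_filter, mem_univ, true_and] at hω hω'
    apply hAB
    have key : ∀ D ∈ C, (∀ i, ω i ∈ D) → Submodule.span F (Set.range ω) = D := by
      intro D hD hωD
      refine Submodule.eq_of_le_of_finrank_eq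
        (Submodule.span_le.mpr (by rintro _ ⟨i, rfl⟩; exact hωD i)) ?_
      rw [finrank_span_eq_card hω.1, hC D hD, Fintype.card_fin]
    rw [← key A hA hω.2, ← key B hB hω'.2]

/-- The number of `r`-dimensional subspaces meeting a given `r`-dimensional subspace in
codimension `i`. -/
theorem card_submodules_finrank_inf_le {r i : ℕ} (hir : i ≤ r) (A : Submodule F E)
    (hA : finrank F A = r) (C : Finset (Submodule F E))
    (hC : ∀ B ∈ C, finrank F B = r) (hCA : ∀ B ∈ C, finrank F (A ⊓ B : Submodule F E) = r - i) :
    #C * (1 - (Fintype.card F : ℝ)⁻¹) ^ r ≤ (Fintype.card F : ℝ) ^ (i * (finrank F E - i)) := by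
  have hq : 1 < Fintype.card F := Fintype.one_lt_card
  have hq1 : (1 : ℝ) < Fintype.card F := by exact_mod_cast hq
  have hq' : (0 : ℝ) < Fintype.card F := by positivity
  have hρ : 0 < 1 - (Fintype.card F : ℝ)⁻¹ := by
    have := inv_lt_one_of_one_lt₀ hq1
    linarith
  have hrE : r ≤ finrank F E := hA ▸ Submodule.finrank_le A
  set q : ℝ := (Fintype.card F : ℝ) with hqdef
  set ρ : ℝ := 1 - q⁻¹
  obtain ⟨s, hs⟩ := Nat.exists_eq_add_of_le hrE
  obtain ⟨j, rfl⟩ := Nat.exists_eq_add_of_le' hir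
  rw [Nat.add_sub_cancel] at hCA
  set I : Finset (Submodule F E) := C.image (fun B => A ⊓ B) with hI
  have hIcard : #I * ρ ^ j ≤ q ^ (j * i) := by
    have h1 := card_submodules_le j (I.image (fun B => B.comap A.subtype)) (by
      intro D hD
      simp only [hI, mem_image] at hD
      obtain ⟨_, ⟨B, hB, rfl⟩, rfl⟩ := hD
      rw [← hCA B hB]
      exact (Submodule.comapSubtypeEquivOfLe inf_le_left).finrank_eq)
    rw [card_image_of_injOn, hA, ← mul_assoc, mul_add, pow_add] at h1
    · exact le_of_mul_le_mul_right (by rw [mul_comm (q ^ (j * i))]; exact h1)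
        (by positivity : 0 < q ^ (j * j))
    · intro D hD D' hD' h
      simp only [hI, coe_image, Set.mem_image, mem_coe] at hD hD'
      obtain ⟨B, hB, rfl⟩ := hD
      obtain ⟨B', hB', rfl⟩ := hD'
      have := congrArg (Submodule.map A.subtype) h
      simpa [Submodule.map_comap_subtype] using this
  have hfib : ∀ D ∈ I, (#{B ∈ C | A ⊓ B = D} : ℝ) * ρ ^ i ≤ q ^ (i * s) := by
    intro D hD
    simp only [hI, mem_image] at hD
    obtain ⟨B₀, hB₀, rfl⟩ := hD
    set D := A ⊓ B₀
    have hDr : finrank F D = j := hCA B₀ hB₀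
    have hDle : ∀ B ∈ C.filter (fun B => A ⊓ B = D), D ≤ B := by
      intro B hB
      rw [← (mem_filter.mp hB).2]
      exact inf_le_right
    have hEq := Submodule.finrank_quotient_add_finrank D
    have h1 := card_submodules_le (E := E ⧸ D) i
      ((C.filter (fun B => A ⊓ B = D)).image (fun B => B.map D.mkQ)) (by
      intro G hG
      simp only [mem_image] at hG
      obtain ⟨B, hB, rfl⟩ := hG
      have h2 := LinearMap.finrank_range_add_finrank_ker (D.mkQ.domRestrict B)
      rw [LinearMap.range_domRestrict, LinearMap.ker_domRestrict, Submodule.ker_mkQ,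
        (Submodule.comapSubtypeEquivOfLe (hDle B hB)).finrank_eq, hDr,
        hC B (mem_filter.mp hB).1] at h2
      omega)
    have h3 : finrank F (E ⧸ D) = i + s := by omega
    rw [card_image_of_injOn, h3, ← mul_assoc, mul_add, pow_add] at h1
    · exact le_of_mul_le_mul_right (by rw [mul_comm (q ^ (i * s))]; exact h1)
        (by positivity : 0 < q ^ (i * i))
    · intro B hB B' hB' h
      have := congrArg (Submodule.comap D.mkQ) h
      simpa [Submodule.comap_map_mkQ, sup_eq_right.mpr (hDle B hB),
        sup_eq_right.mpr (hDle B' hB')] using this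
  have hsum : (#C : ℝ) = ∑ D ∈ I, (#{B ∈ C | A ⊓ B = D} : ℝ) := by
    rw [card_eq_sum_card_image (fun B => A ⊓ B) C]
    push_cast; rfl
  calc (#C : ℝ) * ρ ^ (j + i) = (∑ D ∈ I, (#{B ∈ C | A ⊓ B = D} : ℝ) * ρ ^ i) * ρ ^ j := by
        rw [← sum_mul, ← hsum]; ring
    _ ≤ (∑ D ∈ I, q ^ (i * s)) * ρ ^ j := by
        gcongr with D hD
        exact hfib D hD
    _ = (#I * ρ ^ j) * q ^ (i * s) := by rw [sum_const, nsmul_eq_mul]; ring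
    _ ≤ q ^ (j * i) * q ^ (i * s) := by gcongr
    _ = _ := by
        rw [← pow_add, hs]
        congr 1
        have : j + i + s - i = j + s := by omega
        rw [this]; ring

end Counting

section SecondMoment

open Classical Module Finset

variable {F E : Type*} [Field F] [Fintype F] [AddCommGroup E] [Module F E] [Fintype E]

theorem sum_range_pow_mul_sub_le {q : ℝ} (hq : 1 < q) (k u : ℕ) :
    ∑ i ∈ range (k + 1), q ^ (i * (2 * k + 2 + u - i)) ≤
      (1 + k * q⁻¹) * q ^ (k * (k + 2 + u)) := by
  have hq0 : 0 < q := by linarith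
  rw [sum_range_succ, add_mul, one_mul, add_comm]
  have hlast : 2 * k + 2 + u - k = k + 2 + u := by omega
  rw [hlast]
  gcongr
  calc ∑ i ∈ range k, q ^ (i * (2 * k + 2 + u - i))
      ≤ ∑ _i ∈ range k, q⁻¹ * q ^ (k * (k + 2 + u)) := by
        refine sum_le_sum fun i hi => ?_
        obtain ⟨w, rfl⟩ := Nat.exists_eq_add_of_lt (mem_range.mp hi)
        rw [inv_mul_eq_div, le_div_iff₀ hq0, ← pow_succ]
        refine pow_le_pow_right₀ hq.le ?_
        have : 2 * (i + w + 1) + 2 + u - i = i + 2 * w + 4 + u := by omega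
        rw [this]
        nlinarith [Nat.zero_le (w * u), Nat.zero_le (w * w), Nat.zero_le (i * u)]
    _ = k * q⁻¹ * q ^ (k * (k + 2 + u)) := by
        rw [sum_const, card_range, nsmul_eq_mul, mul_assoc]

theorem sum_pow_finrank_inf_le {k m u r : ℕ} (hr : r = m + k + 1 + u)
    (hE : finrank F E = r + (k + 1)) (C : Finset (Submodule F E))
    (hC : ∀ B ∈ C, finrank F B = r) (A : Submodule F E) (hA : finrank F A = r) :
    ∑ B ∈ C, (Fintype.card F : ℝ) ^ (m * finrank F (A ⊓ B : Submodule F E)) ≤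
      #C * (Fintype.card F : ℝ) ^ (m * (m + u)) +
        (Fintype.card F : ℝ) ^ (m * r) * (((1 - (Fintype.card F : ℝ)⁻¹) ^ r)⁻¹ *
          (1 + k * (Fintype.card F : ℝ)⁻¹) * (Fintype.card F : ℝ) ^ (k * (k + 2 + u))) := by
  have hq1 : (1 : ℝ) < Fintype.card F := by exact_mod_cast Fintype.one_lt_card
  have hq0 : (0 : ℝ) < Fintype.card F := by linarith
  have hρ : 0 < 1 - (Fintype.card F : ℝ)⁻¹ := by
    have := inv_lt_one_of_one_lt₀ hq1
    linarith
  set q : ℝ := (Fintype.card F : ℝ)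
  set ρ : ℝ := 1 - q⁻¹
  have hpt : ∀ B ∈ C, q ^ (m * finrank F (A ⊓ B : Submodule F E)) ≤ q ^ (m * (m + u)) +
      ∑ i ∈ range (k + 1),
        if finrank F (A ⊓ B : Submodule F E) = r - i then q ^ (m * (r - i)) else 0 := by
    intro B hB
    have h1 := Submodule.finrank_sup_add_finrank_inf_eq A B
    have h2 := Submodule.finrank_le (A ⊔ B)
    have h3 := Submodule.finrank_mono (inf_le_left : A ⊓ B ≤ A)
    rw [hA, hC B hB] at h1
    have hnn : ∀ i ∈ range (k + 1), (0 : ℝ) ≤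
        if finrank F (A ⊓ B : Submodule F E) = r - i then q ^ (m * (r - i)) else 0 := by
      intro i _
      split_ifs <;> positivity
    by_cases hgen : finrank F (A ⊓ B : Submodule F E) = m + u
    · have hpow : q ^ (m * finrank F (A ⊓ B : Submodule F E)) = q ^ (m * (m + u)) := by rw [hgen]
      rw [hpow]
      exact le_add_of_nonneg_right (sum_nonneg hnn)
    · have hi : r - finrank F (A ⊓ B : Submodule F E) ∈ range (k + 1) := by
        rw [mem_range]; omega
      have h4 := single_le_sum hnn hi
      have h5 : r - (r - finrank F (A ⊓ B : Submodule F E)) =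
          finrank F (A ⊓ B : Submodule F E) := by omega
      rw [h5, if_pos rfl] at h4
      have : 0 < q ^ (m * (m + u)) := by positivity
      linarith
  refine (sum_le_sum hpt).trans ?_
  rw [sum_add_distrib, sum_const, nsmul_eq_mul, sum_comm]
  gcongr
  calc ∑ i ∈ range (k + 1), ∑ B ∈ C,
        (if finrank F (A ⊓ B : Submodule F E) = r - i then q ^ (m * (r - i)) else 0)
      ≤ ∑ i ∈ range (k + 1), q ^ (m * r) * (ρ ^ r)⁻¹ * q ^ (i * (2 * k + 2 + u - i)) := by
        refine sum_le_sum fun i hi => ?_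
        have hi := mem_range.mp hi
        have h1 := card_submodules_finrank_inf_le (i := i) (by omega) A hA
          (C.filter fun B => finrank F (A ⊓ B : Submodule F E) = r - i)
          (fun B hB => hC B (mem_filter.mp hB).1) (fun B hB => (mem_filter.mp hB).2)
        rw [← sum_filter, sum_const, nsmul_eq_mul]
        have hρr : 0 < ρ ^ r := by positivity
        rw [← le_div_iff₀ hρr] at h1
        calc _ ≤ q ^ (i * (finrank F E - i)) / ρ ^ r * q ^ (m * (r - i)) := by gcongr
          _ = (ρ ^ r)⁻¹ * q ^ (i * (finrank F E - i) + m * (r - i)) := by rw [pow_add]; ring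
          _ = (ρ ^ r)⁻¹ * q ^ (m * r + i * (2 * k + 2 + u - i)) := by
            congr 2
            obtain ⟨w, rfl⟩ := Nat.exists_eq_add_of_le (Nat.lt_succ_iff.mp hi)
            have e1 : finrank F E - i = 2 * (i + w) + 2 + u - i + m := by omega
            obtain ⟨y, hy⟩ := Nat.exists_eq_add_of_le (show i ≤ r by omega)
            have e2 : r - i = y := by omega
            rw [e1, e2, hy]
            ring
          _ = _ := by rw [pow_add]; ring
    _ = q ^ (m * r) * (ρ ^ r)⁻¹ * ∑ i ∈ range (k + 1), q ^ (i * (2 * k + 2 + u - i)) := by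
        rw [mul_sum]
    _ ≤ q ^ (m * r) * (ρ ^ r)⁻¹ * ((1 + k * q⁻¹) * q ^ (k * (k + 2 + u))) := by
        gcongr
        exact sum_range_pow_mul_sub_le hq1 k u
    _ = _ := by ring

/-- Second moment method: among `m`-tuples of vectors, many linearly independent ones lie in more
than `T` members of a family of subspaces. -/
theorem card_rich_tuples_ge {k m u r T : ℕ} (hT : 0 < T) (hr : r = m + k + 1 + u)
    (hE : finrank F E = r + (k + 1)) (C : Finset (Submodule F E))
    (hC : ∀ B ∈ C, finrank F B = r) (hcard : #C = 2 * T * Fintype.card F ^ (m * (k + 1)))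
    (hθ : 1 ≤ 2 * (1 - (Fintype.card F : ℝ)⁻¹) ^ m) :
    T * (2 * (1 - (Fintype.card F : ℝ)⁻¹) ^ m - 1) ^ 2 *
        (Fintype.card F : ℝ) ^ (m * (r + (k + 1))) ≤
      #{ω : Fin m → E | LinearIndependent F ω ∧ T < #{B ∈ C | ∀ i, ω i ∈ B}} *
        (T + 2 * (((1 - (Fintype.card F : ℝ)⁻¹) ^ r)⁻¹ *
          (1 + k * (Fintype.card F : ℝ)⁻¹) * (Fintype.card F : ℝ) ^ (k * (k + 2 + u)))) := by
  have hq1 : (1 : ℝ) < Fintype.card F := by exact_mod_cast Fintype.one_lt_card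
  have hq0 : (0 : ℝ) < Fintype.card F := by linarith
  have hpair := fun A hA => sum_pow_finrank_inf_le (m := m) hr hE C hC A (hC A hA)
  have hmem : ∀ A ∈ C, (1 - (Fintype.card F : ℝ)⁻¹) ^ m * (Fintype.card F : ℝ) ^ (m * r) ≤
      #{ω : Fin m → E | LinearIndependent F ω ∧ ∀ i, ω i ∈ A} := by
    intro A hA
    have := le_card_linearIndependent_mem m A (by rw [hC A hA]; omega)
    rwa [hC A hA] at this
  have hcard' : (#C : ℝ) = 2 * T * (Fintype.card F : ℝ) ^ (m * (k + 1)) := by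
    rw [hcard]; push_cast; ring
  set X : (Fin m → E) → ℝ := fun ω => (#{B ∈ C | ∀ i, ω i ∈ B} : ℝ) with hX
  have hXsum : ∀ ω, X ω = ∑ B ∈ C, if ∀ i, ω i ∈ B then (1 : ℝ) else 0 := by
    intro ω
    simp only [hX, card_filter]
    push_cast; rfl
  have hfirst : ∑ ω, X ω = #C * (Fintype.card F : ℝ) ^ (m * r) := by
    simp_rw [hXsum]
    rw [sum_comm, ← nsmul_eq_mul, ← sum_const]
    refine sum_congr rfl fun B hB => ?_
    rw [sum_boole, card_tuples_mem, hC B hB]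
    push_cast; rfl
  have hsecond : ∑ ω, X ω ^ 2 =
      ∑ A ∈ C, ∑ B ∈ C, (Fintype.card F : ℝ) ^ (m * finrank F (A ⊓ B : Submodule F E)) := by
    simp_rw [hXsum, sq, sum_mul_sum]
    rw [sum_comm]
    refine sum_congr rfl fun A _ => ?_
    rw [sum_comm]
    refine sum_congr rfl fun B _ => ?_
    have h1 := card_tuples_mem m (A ⊓ B)
    rw [← Nat.cast_pow, ← h1, card_filter]
    push_cast
    refine sum_congr rfl fun ω _ => ?_
    simp only [Submodule.mem_inf, forall_and, ite_and, mul_ite, mul_one, mul_zero]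
    split_ifs <;> rfl
  set q : ℝ := (Fintype.card F : ℝ)
  set θ : ℝ := (1 - q⁻¹) ^ m
  set L : ℝ := ((1 - q⁻¹) ^ r)⁻¹ * (1 + k * q⁻¹) * q ^ (k * (k + 2 + u))
  set M : ℝ := q ^ (m * (r + (k + 1)))
  have hM : M = q ^ (m * (k + 1)) * q ^ (m * r) := by
    rw [← pow_add]; ring
  have hM0 : 0 < M := by positivity
  have hT' : (0 : ℝ) < T := by exact_mod_cast hT
  set R : Finset (Fin m → E) := {ω | LinearIndependent F ω ∧ T < #{B ∈ C | ∀ i, ω i ∈ B}} with hR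
  have hcardE : (Fintype.card (Fin m → E) : ℝ) = M := by
    rw [Fintype.card_fun, Module.card_eq_pow_finrank (K := F) (V := E), hE, Fintype.card_fin,
      ← pow_mul, mul_comm]
    push_cast; rfl
  have hupper : ∑ ω, (X ω - T) ^ 2 ≤ M * (T ^ 2 + 2 * T * L) := by
    have h1 : ∑ ω, (X ω - T) ^ 2 = ∑ ω, X ω ^ 2 - 2 * T * ∑ ω, X ω + M * T ^ 2 := by
      rw [← hcardE, mul_sum, ← sum_sub_distrib, ← Finset.card_univ, ← nsmul_eq_mul, ← sum_const,
        ← sum_add_distrib]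
      exact sum_congr rfl fun ω _ => by ring
    have h2 : ∑ ω, X ω ^ 2 ≤ #C * (#C * q ^ (m * (m + u)) + q ^ (m * r) * L) := by
      rw [hsecond, ← nsmul_eq_mul, ← sum_const]
      exact sum_le_sum hpair
    have h3 : q ^ (m * (k + 1)) * q ^ (m * (m + u)) = q ^ (m * r) := by
      rw [← pow_add, hr]; ring
    have h4 : (#C : ℝ) * (#C * q ^ (m * (m + u)) + q ^ (m * r) * L) =
        M * (4 * T ^ 2 + 2 * T * L) := by
      rw [hcard', hM]
      calc _ = 2 * T * q ^ (m * (k + 1)) * (2 * T * (q ^ (m * (k + 1)) * q ^ (m * (m + u))) +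
            q ^ (m * r) * L) := by ring
        _ = _ := by rw [h3]; ring
    have h5 : 2 * T * ∑ ω, X ω = M * (4 * T ^ 2) := by
      rw [hfirst, hcard', hM]; ring
    rw [h1, h5]
    rw [h4] at h2
    linarith
  have hlower : M * (T * (2 * θ - 1)) ≤ ∑ ω ∈ R, (X ω - T) := by
    set I : Finset (Fin m → E) := {ω | LinearIndependent F ω} with hI
    have h1 : ∑ ω ∈ I, (X ω - T) ≤ ∑ ω ∈ R, (X ω - T) := by
      have hRI : R = I.filter (fun ω => T < #{B ∈ C | ∀ i, ω i ∈ B}) := by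
        rw [hI, filter_filter]
      rw [hRI, ← sum_filter_add_sum_filter_not I (fun ω => T < #{B ∈ C | ∀ i, ω i ∈ B})]
      refine add_le_of_nonpos_right (sum_nonpos fun ω hω => ?_)
      have := not_lt.mp (mem_filter.mp hω).2
      have : X ω ≤ T := Nat.cast_le.mpr this
      linarith
    have h2 : #C * (θ * q ^ (m * r)) ≤ ∑ ω ∈ I, X ω := by
      simp_rw [hXsum]
      rw [sum_comm, ← nsmul_eq_mul, ← sum_const]
      refine sum_le_sum fun B hB => ?_
      rw [sum_boole, hI, filter_filter]
      exact hmem B hB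
    have h3 : (#I : ℝ) ≤ M := by
      rw [← hcardE]
      exact Nat.cast_le.mpr (card_le_univ I)
    rw [sum_sub_distrib, sum_const, nsmul_eq_mul] at h1
    have h4 : (#C : ℝ) * (θ * q ^ (m * r)) = M * (2 * T * θ) := by
      rw [hcard', hM]; ring
    have h5 : (#I : ℝ) * T ≤ M * T := by gcongr
    linarith
  have hcs : (∑ ω ∈ R, (X ω - T)) ^ 2 ≤ #R * (M * (T ^ 2 + 2 * T * L)) := by
    refine sq_sum_le_card_mul_sum_sq.trans ?_
    gcongr
    exact (sum_le_sum_of_subset_of_nonneg (subset_univ R) fun ω _ _ => sq_nonneg _).trans hupper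
  have h2θ : 0 ≤ 2 * θ - 1 := by linarith
  have hsq : (M * (T * (2 * θ - 1))) ^ 2 ≤ #R * (M * (T ^ 2 + 2 * T * L)) :=
    (pow_le_pow_left₀ (by positivity) hlower 2).trans hcs
  refine le_of_mul_le_mul_left ?_ (mul_pos hM0 hT')
  calc M * T * (T * (2 * θ - 1) ^ 2 * M) = (M * (T * (2 * θ - 1))) ^ 2 := by ring
    _ ≤ _ := hsq
    _ = _ := by ring

end SecondMoment

section Planes

open Module

variable {F : Type} [Field F] {d : ℕ}

/-- The affine functionals `x ↦ f x + c` vanishing on `S`, as pairs `(f, c)`. -/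
def vanishingFunctionals (S : Set (Fin d → F)) : Submodule F (Dual F (Fin d → F) × F) where
  carrier := {p | ∀ x ∈ S, p.1 x + p.2 = 0}
  add_mem' hp hp' x hx := by
    have h1 := hp x hx
    have h2 := hp' x hx
    simp only [Prod.fst_add, Prod.snd_add, LinearMap.add_apply]
    linear_combination h1 + h2
  zero_mem' := by simp
  smul_mem' a p hp x hx := by
    have h1 := hp x hx
    simp only [Prod.smul_fst, Prod.smul_snd, LinearMap.smul_apply, smul_eq_mul]
    linear_combination a * h1

theorem mem_vanishingFunctionals {S : Set (Fin d → F)} {p : Dual F (Fin d → F) × F} :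
    p ∈ vanishingFunctionals S ↔ ∀ x ∈ S, p.1 x + p.2 = 0 :=
  Iff.rfl

theorem mem_vanishingFunctionals_vadd {W : Submodule F (Fin d → F)} {x : Fin d → F}
    {p : Dual F (Fin d → F) × F} :
    p ∈ vanishingFunctionals (x +ᵥ (W : Set (Fin d → F))) ↔
      p.1 ∈ W.dualAnnihilator ∧ p.2 = -p.1 x := by
  rw [mem_vanishingFunctionals, Submodule.mem_dualAnnihilator]
  constructor
  · intro h
    have h0 := h x ⟨0, W.zero_mem, by simp⟩
    refine ⟨fun w hw => ?_, by linear_combination h0⟩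
    have h1 := h (x + w) ⟨w, hw, rfl⟩
    rw [map_add] at h1
    linear_combination h1 - h0
  · rintro ⟨h1, h2⟩ _ ⟨w, hw, rfl⟩
    have := h1 w hw
    simp only [vadd_eq_add, map_add]
    linear_combination this + h2

theorem finrank_vanishingFunctionals {j : ℕ} {S : Set (Fin d → F)} (hS : IsAffinePlane F d j S) :
    finrank F (vanishingFunctionals S) = d - j := by
  obtain ⟨W, x, hW, rfl⟩ := hS
  let e : W.dualAnnihilator ≃ₗ[F] vanishingFunctionals (x +ᵥ (W : Set (Fin d → F))) :=
    { toFun := fun f => ⟨(f, -(f : Dual F (Fin d → F)) x),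
        mem_vanishingFunctionals_vadd.mpr ⟨f.2, rfl⟩⟩
      invFun := fun p => ⟨p.1.1, (mem_vanishingFunctionals_vadd.mp p.2).1⟩
      left_inv := fun f => rfl
      right_inv := fun p => Subtype.ext
        (Prod.ext rfl (mem_vanishingFunctionals_vadd.mp p.2).2.symm)
      map_add' := fun f g => Subtype.ext (Prod.ext rfl (neg_add _ _))
      map_smul' := fun a f => Subtype.ext (Prod.ext rfl (mul_neg _ _).symm) }
  have h := Subspace.finrank_add_finrank_dualAnnihilator_eq W
  rw [finrank_fin_fun] at h
  rw [← e.finrank_eq]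
  omega

theorem mem_of_forall_vanishingFunctionals {j : ℕ} {S : Set (Fin d → F)}
    (hS : IsAffinePlane F d j S) {y : Fin d → F}
    (hy : ∀ p ∈ vanishingFunctionals S, p.1 y + p.2 = 0) : y ∈ S := by
  obtain ⟨W, x, hW, rfl⟩ := hS
  refine ⟨y - x, ?_, by simp⟩
  rw [SetLike.mem_coe, ← Subspace.dualAnnihilator_dualCoannihilator_eq (W := W),
    Submodule.mem_dualCoannihilator]
  intro f hf
  have := hy (f, -f x) (mem_vanishingFunctionals_vadd.mpr ⟨hf, rfl⟩)
  rw [map_sub]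
  linear_combination this

theorem vanishingFunctionals_injOn (j : ℕ) :
    Set.InjOn (vanishingFunctionals (F := F) (d := d)) {S | IsAffinePlane F d j S} := by
  intro S hS S' hS' h
  ext y
  constructor
  · intro hy
    exact mem_of_forall_vanishingFunctionals hS' fun p hp => (h ▸ hp) y hy
  · intro hy
    exact mem_of_forall_vanishingFunctionals hS fun p hp => (h ▸ hp) y hy

/-- The common zero set of a tuple of affine functionals. -/
def commonZeros {m : ℕ} (ω : Fin m → Dual F (Fin d → F) × F) : Set (Fin d → F) :=
  {x | ∀ i, (ω i).1 x + (ω i).2 = 0}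

theorem subset_commonZeros_iff {m : ℕ} {ω : Fin m → Dual F (Fin d → F) × F}
    {S : Set (Fin d → F)} : S ⊆ commonZeros ω ↔ ∀ i, ω i ∈ vanishingFunctionals S :=
  ⟨fun h i _ hx => h hx i, fun h x hx i => h i x hx⟩

theorem isAffinePlane_commonZeros {m : ℕ} {ω : Fin m → Dual F (Fin d → F) × F}
    (hω : LinearIndependent F ω) (hne : (commonZeros ω).Nonempty) :
    IsAffinePlane F d (d - m) (commonZeros ω) := by
  obtain ⟨x, hx⟩ := hne
  have hli : LinearIndependent F fun i => (ω i).1 := by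
    rw [Fintype.linearIndependent_iff] at hω ⊢
    intro g hg
    refine hω g (Prod.ext ?_ ?_)
    · simpa [Prod.fst_sum] using hg
    · have h1 : ∀ i, (ω i).2 = -(ω i).1 x := fun i => by linear_combination hx i
      have h2 := LinearMap.congr_fun hg x
      simp only [LinearMap.sum_apply, LinearMap.smul_apply, LinearMap.zero_apply] at h2
      simp [Prod.snd_sum, h1] at h2 ⊢
      exact h2
  refine ⟨(Submodule.span F (Set.range fun i => (ω i).1)).dualCoannihilator, x, ?_, ?_⟩
  · have h1 := Subspace.finrank_add_finrank_dualCoannihilator_eq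
      (Submodule.span F (Set.range fun i => (ω i).1))
    rw [finrank_span_eq_card hli, Fintype.card_fin, finrank_fin_fun] at h1
    omega
  · ext y
    have hmem : y ∈ x +ᵥ ((Submodule.span F
        (Set.range fun i => (ω i).1)).dualCoannihilator : Set (Fin d → F)) ↔
        ∀ i, (ω i).1 (y - x) = 0 := by
      rw [Set.mem_vadd_set_iff_neg_vadd_mem, SetLike.mem_coe, Submodule.mem_dualCoannihilator,
        vadd_eq_add, neg_add_eq_sub]
      constructor
      · intro h i
        exact h _ (Submodule.subset_span ⟨i, rfl⟩)
      · intro h f hf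
        induction hf using Submodule.span_induction with
        | mem f hf => obtain ⟨i, rfl⟩ := hf; exact h i
        | zero => rfl
        | add f g _ _ hf hg => rw [LinearMap.add_apply, hf, hg, add_zero]
        | smul a f _ hf => rw [LinearMap.smul_apply, hf, smul_zero]
    rw [hmem]
    refine forall_congr' fun i => ?_
    have hxi := hx i
    rw [map_sub]
    constructor
    · intro h
      linear_combination h - hxi
    · intro h
      linear_combination h + hxi

open Classical in
/-- Each plane of codimension `m` is the zero set of at most `q^{m²}` tuples of `m` affine
functionals. -/
theorem card_tuples_le_mul_card_planes [Fintype F] [Fintype (Dual F (Fin d → F) × F)] {m h : ℕ}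
    (hm : d - h = m) (R : Finset (Fin m → Dual F (Fin d → F) × F)) (P : Set (Set (Fin d → F)))
    (hP : ∀ S ∈ P, IsAffinePlane F d h S) (hR : ∀ ω ∈ R, commonZeros ω ∈ P) :
    R.card ≤ Fintype.card F ^ (m * m) * Nat.card P := by
  rw [Nat.card_eq_card_toFinset]
  refine Finset.card_le_mul_card_image_of_maps_to (f := commonZeros)
    (fun ω hω => Set.mem_toFinset.mpr (hR ω hω)) _ fun S hS => ?_
  have h1 := card_tuples_mem m (vanishingFunctionals S)
  rw [finrank_vanishingFunctionals (hP S (Set.mem_toFinset.mp hS)), hm] at h1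
  rw [← h1]
  refine Finset.card_le_card fun ω hω => ?_
  simp only [Finset.mem_filter, Finset.mem_univ, true_and] at hω ⊢
  exact subset_commonZeros_iff.mp hω.2.ge

end Planes

section Asymptotics

open Filter Topology

theorem eventually_second_moment_factor_ge (k m r : ℕ) {ε : ℝ} (hε : 0 < ε) :
    ∀ᶠ n : ℕ in atTop, 1 ≤ 2 * (1 - (n : ℝ)⁻¹) ^ m ∧
      (1 - ε) * (((1 - (n : ℝ)⁻¹) ^ r)⁻¹ * (1 + k * (n : ℝ)⁻¹)) ≤
        (2 * (1 - (n : ℝ)⁻¹) ^ m - 1) ^ 2 := by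
  have hinv := tendsto_inv_atTop_nhds_zero_nat (𝕜 := ℝ)
  have h1 : ContinuousAt (fun x : ℝ => 2 * (1 - x) ^ m) 0 := by fun_prop
  have h2 : ContinuousAt (fun x : ℝ => (2 * (1 - x) ^ m - 1) ^ 2) 0 := by fun_prop
  have h3 : ContinuousAt (fun x : ℝ => (1 - ε) * (((1 - x) ^ r)⁻¹ * (1 + k * x))) 0 := by
    refine continuousAt_const.mul (ContinuousAt.mul (ContinuousAt.inv₀ (by fun_prop) (by simp))
      (by fun_prop))
  have e1 := (h1.tendsto.comp hinv).eventually_const_lt (u := 1) (by norm_num)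
  have e2 := (h3.tendsto.comp hinv).eventually_lt (h2.tendsto.comp hinv) (by norm_num; exact hε)
  filter_upwards [e1, e2] with n hn1 hn2
  exact ⟨hn1.le, hn2.le⟩

end Asymptotics

open Classical in
/-- For `t ≥ 2` and `h ≥ 2k+1`, if `𝒦` is a set of k-planes of
`F_q^d` with `|𝒦| ≥ 2(t-1) q^{(d-h)(k+1)}`, then the number of h-planes containing
at least `t` of the k-planes of `𝒦` is at least `c q^{(d-h)(h+1)}` (up to a
`1 - ε` factor for `q` large), where `c = (t-1)/((t-1) + 2 q^{k(h-k+1)})`. -/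
theorem rich_h_planes (d k h : ℕ) (hhk : 2 * k + 1 ≤ h) (hhd : h < d)
    (t : ℕ) (ht : 2 ≤ t) :
    ∀ ε : ℝ, 0 < ε → ∃ q₀ : ℕ,
      ∀ (F : Type) [Field F] [Fintype F],
        q₀ ≤ Fintype.card F → Odd (Fintype.card F) →
        ∀ Ks : Finset (Set (Fin d → F)),
          (∀ K ∈ Ks, IsAffinePlane F d k K) →
          2 * (t - 1) * Fintype.card F ^ ((d - h) * (k + 1)) ≤ Ks.card →
          (1 - ε) *
              (((t : ℝ) - 1) /
                (((t : ℝ) - 1) +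
                  2 * (Fintype.card F : ℝ) ^ (k * (h - k + 1)))) *
              (Fintype.card F : ℝ) ^ ((d - h) * (h + 1)) ≤
            (Nat.card {S : Set (Fin d → F) |
              IsAffinePlane F d h S ∧
                t ≤ (Ks.filter fun K => K ⊆ S).card} : ℝ) := by
  intro ε hε
  obtain ⟨q₀, hq₀⟩ := Filter.eventually_atTop.mp
    (eventually_second_moment_factor_ge k (d - h) (d - k) hε)
  refine ⟨q₀, fun F _ _ hqF _ Ks hKs hcard => ?_⟩
  obtain ⟨hθ, hη⟩ := hq₀ _ hqF
  obtain ⟨Ks', hsub, hcard'⟩ := Finset.exists_subset_card_eq hcard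
  let : Fintype (Module.Dual F (Fin d → F) × F) :=
    @Fintype.ofFinite _ (Module.finite_of_finite F)
  obtain ⟨u, hu⟩ : ∃ u, h = 2 * k + 1 + u := Nat.exists_eq_add_of_le hhk
  obtain ⟨T, rfl⟩ : ∃ T, t = T + 1 := ⟨t - 1, by omega⟩
  have hinj : Set.InjOn (vanishingFunctionals (F := F) (d := d)) Ks' :=
    (vanishingFunctionals_injOn k).mono fun K hK => hKs K (hsub hK)
  have hfin : Module.finrank F (Module.Dual F (Fin d → F) × F) = d - k + (k + 1) := by
    rw [Module.finrank_prod, Subspace.dual_finrank_eq, Module.finrank_fin_fun,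
      Module.finrank_self]
    omega
  have hmain := card_rich_tuples_ge (F := F) (k := k) (m := d - h) (u := u) (r := d - k) (T := T)
    (by omega) (by omega) hfin (Ks'.image vanishingFunctionals)
    (by
      intro B hB
      obtain ⟨K, hK, rfl⟩ := Finset.mem_image.mp hB
      exact finrank_vanishingFunctionals (hKs K (hsub hK)))
    (by rw [Finset.card_image_of_injOn hinj, hcard', Nat.add_sub_cancel]) hθ
  have hfib := card_tuples_le_mul_card_planes (F := F) (d := d) (h := h) rfl
    (Finset.univ.filter fun ω : Fin (d - h) → Module.Dual F (Fin d → F) × F =>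
      LinearIndependent F ω ∧
        T < ((Ks'.image vanishingFunctionals).filter fun B => ∀ i, ω i ∈ B).card)
    {S | IsAffinePlane F d h S ∧ T + 1 ≤ (Ks.filter fun K => K ⊆ S).card}
    (fun S hS => hS.1)
    (by
      intro ω hω
      obtain ⟨hli, hrich⟩ := (Finset.mem_filter.mp hω).2
      have hle : T < (Ks.filter fun K => K ⊆ commonZeros ω).card := by
        refine hrich.trans_le ?_
        rw [Finset.filter_image]
        refine Finset.card_image_le.trans (Finset.card_le_card fun K hK => ?_)
        rw [Finset.mem_filter] at hK ⊢
        exact ⟨hsub hK.1, subset_commonZeros_iff.mpr hK.2⟩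
      obtain ⟨K, hK⟩ := Finset.card_pos.mp (Nat.zero_lt_of_lt hle)
      obtain ⟨hKK, hKω⟩ := Finset.mem_filter.mp hK
      obtain ⟨W, x, -, rfl⟩ := hKs K hKK
      have hplane := isAffinePlane_commonZeros hli ⟨x, hKω ⟨0, W.zero_mem, by simp⟩⟩
      rw [Nat.sub_sub_self hhd.le] at hplane
      exact ⟨hplane, hle⟩)
  have hfib' := (Nat.cast_le (α := ℝ)).mpr hfib
  have hq1 : (1 : ℝ) < Fintype.card F := by exact_mod_cast Fintype.one_lt_card
  have hq0 : (0 : ℝ) < Fintype.card F := by linarith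
  have hρ : 0 < 1 - (Fintype.card F : ℝ)⁻¹ := by
    have := inv_lt_one_of_one_lt₀ hq1
    linarith
  have hT : (0 : ℝ) < T := by exact_mod_cast (by omega : 0 < T)
  have hexp : (d - h) * (d - k + (k + 1)) = (d - h) * (d - h) + (d - h) * (h + 1) := by
    rw [← mul_add]; congr 1; omega
  have hexp' : k + 2 + u = h - k + 1 := by omega
  rw [hexp, pow_add, hexp'] at hmain
  push_cast at hfib' ⊢
  rw [add_sub_cancel_right]
  set q : ℝ := (Fintype.card F : ℝ)
  set η : ℝ := ((1 - q⁻¹) ^ (d - k))⁻¹ * (1 + k * q⁻¹) with hηdef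
  set θ : ℝ := (1 - q⁻¹) ^ (d - h)
  set Q : ℝ := q ^ (k * (h - k + 1))
  set P : ℝ := (Nat.card {S : Set (Fin d → F) |
    IsAffinePlane F d h S ∧ T + 1 ≤ (Ks.filter fun K => K ⊆ S).card} : ℝ)
  have hη0 : 0 < η := by positivity
  have hη1 : 1 ≤ η := by
    have h1 : 1 ≤ ((1 - q⁻¹) ^ (d - k))⁻¹ := by
      refine one_le_inv₀ (by positivity) |>.mpr (pow_le_one₀ hρ.le ?_)
      have : 0 < q⁻¹ := by positivity
      linarith
    have h2 : 1 ≤ 1 + k * q⁻¹ := le_add_of_nonneg_right (by positivity)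
    exact one_le_mul_of_one_le_of_one_le h1 h2
  have hQ0 : 0 < Q := by positivity
  have hP0 : 0 ≤ P := Nat.cast_nonneg _
  have hbound : T * (2 * θ - 1) ^ 2 * q ^ ((d - h) * (h + 1)) ≤ P * (T + 2 * (η * Q)) := by
    refine le_of_mul_le_mul_left ?_ (by positivity : 0 < q ^ ((d - h) * (d - h)))
    calc _ = T * (2 * θ - 1) ^ 2 * (q ^ ((d - h) * (d - h)) * q ^ ((d - h) * (h + 1))) := by ring
      _ ≤ _ := hmain
      _ ≤ q ^ ((d - h) * (d - h)) * P * (T + 2 * (η * Q)) := by gcongr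
      _ = _ := by ring
  rw [mul_div_assoc', div_mul_eq_mul_div, div_le_iff₀ (by positivity)]
  refine le_of_mul_le_mul_left ?_ hη0
  calc η * ((1 - ε) * T * q ^ ((d - h) * (h + 1)))
      = (1 - ε) * η * (T * q ^ ((d - h) * (h + 1))) := by ring
    _ ≤ (2 * θ - 1) ^ 2 * (T * q ^ ((d - h) * (h + 1))) := by gcongr
    _ = T * (2 * θ - 1) ^ 2 * q ^ ((d - h) * (h + 1)) := by ring
    _ ≤ P * (T + 2 * (η * Q)) := hbound
    _ ≤ P * (η * T + 2 * (η * Q)) := by gcongr; exact le_mul_of_one_le_left hT.le hη1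
    _ = _ := by ring
end
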